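/- arXiv:1807.04254 — 12 statements merged into one kernel-verified Lean document; each statement's English description precedes it below -/
import Mathlib

section
/- For every integer n ≥ 1 and all real numbers x and h, one has the expansion (cos(x/n) + i·h·sin(x/n))^n = ∑_{k=0}^{n} C_k(n,h) · exp(i·x·(1 − 2k/n)), where the sum is over integers k from 0 to n. -/
open Complex Finset

/-- The superoscillation coefficients `C_k(n,h)`. -/
noncomputable def supC (n k : ℕ) (h : ℝ) : ℝ :=
  (n.choose k : ℝ) * ((1 + h) / 2) ^ (n - k) * ((1 - h) / 2) ^ k

/-- For every integer `n ≥ 1` and all real `x`, `h`,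
`(cos(x/n) + i h sin(x/n))^n = ∑_{k=0}^n C_k(n,h) exp(i x (1 - 2k/n))`. -/
theorem superoscillating_expansion (n : ℕ) (hn : 1 ≤ n) (x h : ℝ) :
    (Complex.cos ((x : ℂ) / n) + Complex.I * h * Complex.sin ((x : ℂ) / n)) ^ n
      = ∑ k ∈ Finset.range (n + 1),
          (supC n k h : ℂ) * Complex.exp (Complex.I * x * (1 - 2 * k / n)) := by
  have hn0 : (n : ℂ) ≠ 0 := by exact_mod_cast (show n ≠ 0 by omega)
  have hbase : Complex.cos ((x : ℂ) / n) + Complex.I * h * Complex.sin ((x : ℂ) / n)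
      = ((1 - h) / 2 : ℂ) * Complex.exp (-(x / n * Complex.I))
        + ((1 + h) / 2 : ℂ) * Complex.exp (x / n * Complex.I) := by
    rw [← neg_mul, Complex.exp_mul_I, Complex.exp_mul_I, Complex.cos_neg, Complex.sin_neg]
    ring
  rw [hbase, add_pow]
  refine Finset.sum_congr rfl fun k hk => ?_
  have hkn : k ≤ n := Nat.lt_succ_iff.mp (Finset.mem_range.mp hk)
  have hexp : Complex.exp (Complex.I * x * (1 - 2 * k / n))
      = Complex.exp (-(x / n * Complex.I)) ^ k * Complex.exp (x / n * Complex.I) ^ (n - k) := by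
    rw [← Complex.exp_nat_mul, ← Complex.exp_nat_mul, ← Complex.exp_add, Nat.cast_sub hkn]
    congr 1
    field_simp
    ring
  rw [hexp, supC, mul_pow, mul_pow]
  push_cast
  ring
end

section
/- For every real number h and every real L > 0, the superoscillating sequence F_n(x,h) = (cos(x/n) + i·h·sin(x/n))^n converges to e^{i h x} uniformly for x in [−L, L]; that is, sup_{x ∈ [−L,L]} |(cos(x/n) + i·h·sin(x/n))^n − exp(i·h·x)| → 0 as n → ∞. (For h > 1 this exhibits superoscillation: a bounded-band superposition converging to a faster oscillation e^{ihx}.) -/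
open Complex Filter

lemma norm_pow_sub_pow_le_of_norm_le {R : Type*} [NormedCommRing R] [NormOneClass R] {a b : R}
    {M : ℝ} (hM : 1 ≤ M) (ha : ‖a‖ ≤ M) (hb : ‖b‖ ≤ M) (n : ℕ) :
    ‖a ^ n - b ^ n‖ ≤ n * M ^ n * ‖a - b‖ := by
  induction n with
  | zero => simp
  | succ n ih =>
    have hb' : ‖b ^ n‖ ≤ M ^ (n + 1) := calc
      ‖b ^ n‖ ≤ ‖b‖ ^ n := norm_pow_le b n
      _ ≤ M ^ n := by gcongr
      _ ≤ M ^ (n + 1) := pow_le_pow_right₀ hM n.le_succ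
    calc ‖a ^ (n + 1) - b ^ (n + 1)‖ = ‖a * (a ^ n - b ^ n) + b ^ n * (a - b)‖ := by ring_nf
      _ ≤ ‖a‖ * ‖a ^ n - b ^ n‖ + ‖b ^ n‖ * ‖a - b‖ :=
        (norm_add_le _ _).trans (add_le_add (norm_mul_le _ _) (norm_mul_le _ _))
      _ ≤ M * (n * M ^ n * ‖a - b‖) + M ^ (n + 1) * ‖a - b‖ := by gcongr
      _ = ((n + 1 : ℕ) : ℝ) * M ^ (n + 1) * ‖a - b‖ := by push_cast; ring

lemma norm_cos_add_I_mul_sin_le (h t : ℝ) :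
    ‖Complex.cos t + I * h * Complex.sin t‖ ≤ Real.exp (h ^ 2 * t ^ 2) := by
  have hsq : ‖Complex.cos t + I * h * Complex.sin t‖ ^ 2
      = Real.cos t ^ 2 + h ^ 2 * Real.sin t ^ 2 := by
    rw [Complex.sq_norm, Complex.normSq_apply, ← ofReal_cos, ← ofReal_sin]
    simp only [add_re, mul_re, I_re, ofReal_re, zero_mul, I_im, ofReal_im, mul_zero, sub_self,
      mul_im, one_mul, zero_add, add_zero, add_im]
    ring
  have hexp : 1 ≤ Real.exp (h ^ 2 * t ^ 2) := Real.one_le_exp (by positivity)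
  refine le_of_sq_le_sq ?_ (by positivity)
  calc ‖Complex.cos t + I * h * Complex.sin t‖ ^ 2
      = Real.cos t ^ 2 + h ^ 2 * Real.sin t ^ 2 := hsq
    _ ≤ 1 + h ^ 2 * t ^ 2 := by
      exact add_le_add (Real.cos_sq_le_one t)
        (mul_le_mul_of_nonneg_left Real.sin_sq_le_sq (sq_nonneg h))
    _ ≤ Real.exp (h ^ 2 * t ^ 2) := by linarith [Real.add_one_le_exp (h ^ 2 * t ^ 2)]
    _ ≤ Real.exp (h ^ 2 * t ^ 2) ^ 2 := le_self_pow₀ hexp two_ne_zero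

lemma norm_cos_add_I_mul_sin_sub_exp_le {h t : ℝ} (ht : |t| ≤ 1) (hht : |h * t| ≤ 1) :
    ‖Complex.cos t + I * h * Complex.sin t - Complex.exp (I * h * t)‖
      ≤ (1 + |h| + h ^ 2) * t ^ 2 := by
  have hexp (s : ℝ) (hs : |s| ≤ 1) : ‖Complex.exp (s * I) - 1 - s * I‖ ≤ s ^ 2 := by
    simpa using Complex.norm_exp_sub_one_sub_id_le (x := s * I) (by simpa using hs)
  have hre : |Real.cos t - 1| ≤ t ^ 2 := by
    simpa [Complex.exp_ofReal_mul_I_re] using (Complex.abs_re_le_norm _).trans (hexp t ht)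
  have him : |Real.sin t - t| ≤ t ^ 2 := by
    simpa [Complex.exp_ofReal_mul_I_im] using (Complex.abs_im_le_norm _).trans (hexp t ht)
  have hdecomp : Complex.cos t + I * h * Complex.sin t - Complex.exp (I * h * t)
      = ((Real.cos t - 1 : ℝ) : ℂ) + I * h * ((Real.sin t - t : ℝ) : ℂ)
        - (Complex.exp ((h * t : ℝ) * I) - 1 - (h * t : ℝ) * I) := by
    rw [show I * h * t = ((h * t : ℝ) : ℂ) * I by push_cast; ring]
    push_cast
    ring
  calc ‖Complex.cos t + I * h * Complex.sin t - Complex.exp (I * h * t)‖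
      ≤ ‖((Real.cos t - 1 : ℝ) : ℂ)‖ + ‖I * h * ((Real.sin t - t : ℝ) : ℂ)‖
        + ‖Complex.exp ((h * t : ℝ) * I) - 1 - (h * t : ℝ) * I‖ :=
        hdecomp ▸ (norm_sub_le _ _).trans (add_le_add_left (norm_add_le _ _) _)
    _ = |Real.cos t - 1| + |h| * |Real.sin t - t|
        + ‖Complex.exp ((h * t : ℝ) * I) - 1 - (h * t : ℝ) * I‖ := by
      simp only [norm_mul, norm_I, one_mul, norm_real, Real.norm_eq_abs]
    _ ≤ t ^ 2 + |h| * t ^ 2 + (h * t) ^ 2 := by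
      gcongr
      exact hexp _ hht
    _ = (1 + |h| + h ^ 2) * t ^ 2 := by ring

lemma norm_cos_add_I_mul_sin_pow_sub_exp_le {h L x : ℝ} {n : ℕ} (hn : 1 ≤ n) (hLn : L ≤ n)
    (hhLn : |h| * L ≤ n) (hx : |x| ≤ L) :
    ‖(Complex.cos ((x : ℂ) / n) + I * h * Complex.sin ((x : ℂ) / n)) ^ n
        - Complex.exp (I * h * x)‖
      ≤ Real.exp (h ^ 2 * L ^ 2) * (1 + |h| + h ^ 2) * L ^ 2 / n := by
  have hn1 : (1 : ℝ) ≤ n := by exact_mod_cast hn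
  have hn0 : (0 : ℝ) < n := by linarith
  have hnC : (n : ℂ) ≠ 0 := by exact_mod_cast hn0.ne'
  have hxsq : x ^ 2 ≤ L ^ 2 := sq_le_sq' (abs_le.mp hx).1 (abs_le.mp hx).2
  obtain ⟨t, rfl⟩ : ∃ t : ℝ, x = n * t := ⟨x / n, by field_simp⟩
  have ht : |t| ≤ 1 := by
    rw [abs_mul, Nat.abs_cast] at hx
    exact le_of_mul_le_mul_left (by linarith) hn0
  have hht : |h * t| ≤ 1 := by
    refine le_of_mul_le_mul_left ?_ hn0
    calc n * |h * t| = |h| * |n * t| := by rw [abs_mul, abs_mul, Nat.abs_cast]; ring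
      _ ≤ |h| * L := by gcongr
      _ ≤ n * 1 := by linarith
  have hexp : Complex.exp (I * h * (n * t : ℝ)) = Complex.exp (I * h * t) ^ n := by
    rw [← Complex.exp_nat_mul]
    push_cast
    ring_nf
  have hdiv : ((n * t : ℝ) : ℂ) / n = t := by
    push_cast
    field_simp
  have hM : 1 ≤ Real.exp (h ^ 2 * t ^ 2) := Real.one_le_exp (by positivity)
  have hb : ‖Complex.exp (I * h * t)‖ ≤ Real.exp (h ^ 2 * t ^ 2) := by
    rw [show I * h * t = ((h * t : ℝ) : ℂ) * I by push_cast; ring, norm_exp_ofReal_mul_I]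
    exact hM
  have hMn : Real.exp (h ^ 2 * t ^ 2) ^ n ≤ Real.exp (h ^ 2 * L ^ 2) := by
    rw [← Real.exp_nat_mul]
    refine Real.exp_le_exp.mpr ?_
    calc n * (h ^ 2 * t ^ 2) ≤ n * (n * (h ^ 2 * t ^ 2)) :=
          le_mul_of_one_le_left (by positivity) hn1 |>.trans_eq (by ring)
      _ = h ^ 2 * (n * t) ^ 2 := by ring
      _ ≤ h ^ 2 * L ^ 2 := by gcongr
  rw [hexp, hdiv]
  calc _ ≤ n * Real.exp (h ^ 2 * t ^ 2) ^ n
          * ‖Complex.cos t + I * h * Complex.sin t - Complex.exp (I * h * t)‖ :=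
        norm_pow_sub_pow_le_of_norm_le hM (norm_cos_add_I_mul_sin_le h t) hb n
    _ ≤ n * Real.exp (h ^ 2 * L ^ 2) * ((1 + |h| + h ^ 2) * t ^ 2) := by
      gcongr
      exact norm_cos_add_I_mul_sin_sub_exp_le ht hht
    _ = Real.exp (h ^ 2 * L ^ 2) * (1 + |h| + h ^ 2) * (n * t) ^ 2 / n := by
      field_simp
    _ ≤ Real.exp (h ^ 2 * L ^ 2) * (1 + |h| + h ^ 2) * L ^ 2 / n := by gcongr

/-- For every real `h` and `L > 0`, the superoscillating sequence
`F_n(x,h) = (cos(x/n) + i h sin(x/n))^n` converges to `exp(i h x)` uniformly on `[-L, L]`. -/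
theorem superoscillating_uniform_limit (h L : ℝ) (hL : 0 < L) :
    TendstoUniformlyOn
      (fun (n : ℕ) (x : ℝ) =>
        (Complex.cos ((x : ℂ) / n) + Complex.I * h * Complex.sin ((x : ℂ) / n)) ^ n)
      (fun x : ℝ => Complex.exp (Complex.I * h * x))
      Filter.atTop (Set.Icc (-L) L) := by
  rw [Metric.tendstoUniformlyOn_iff]
  intro ε hε
  have hlim := tendsto_const_div_atTop_nhds_zero_nat
    (Real.exp (h ^ 2 * L ^ 2) * (1 + |h| + h ^ 2) * L ^ 2)
  filter_upwards [hlim.eventually_lt_const hε, eventually_ge_atTop 1,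
    tendsto_natCast_atTop_atTop.eventually_ge_atTop L,
    tendsto_natCast_atTop_atTop.eventually_ge_atTop (|h| * L)] with n hnε hn hLn hhLn x hx
  rw [dist_comm, dist_eq_norm]
  exact (norm_cos_add_I_mul_sin_pow_sub_exp_le hn hLn hhLn (abs_le.mpr hx)).trans_lt hnε
end

section
/- Let I ⊆ ℝ be an open interval containing a point t₀, let a, b, c, d : I → ℝ with a and d differentiable on I and a(t) ≠ 0 for all t ∈ I, and set τ(t) := a'(t)/a(t) − 2c(t) + 4d(t) and σ(t) := a(t)b(t) − c(t)d(t) + d(t)² + d(t)a'(t)/(2a(t)) − d'(t)/2. Suppose μ₀ : I → ℝ is twice differentiable and satisfies the characteristic equation μ₀''(t) − τ(t)·μ₀'(t) + 4σ(t)·μ₀(t) = 0 on I, and suppose μ₀(t₀) ≠ 0. Then the function α(t) := μ₀'(t)/(4a(t)μ₀(t)) − d(t)/(2a(t)) satisfies the Riccati equation α'(t₀) + b(t₀) + 2c(t₀)·α(t₀) + 4a(t₀)·α(t₀)² = 0. -/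
open Set

/-- If `μ₀` solves the characteristic equation
`μ₀'' − τ μ₀' + 4σ μ₀ = 0` on an open interval `I` and `μ₀(t₀) ≠ 0`, then
`α = μ₀'/(4aμ₀) − d/(2a)` satisfies the Riccati equation
`α' + b + 2cα + 4aα² = 0` at `t₀`. -/
theorem characteristic_to_riccati (x₁ x₂ t₀ : ℝ) (ht₀ : t₀ ∈ Set.Ioo x₁ x₂)
    (a b c d a' d' μ₀ μ₀' μ₀'' : ℝ → ℝ)
    (ha : ∀ t ∈ Set.Ioo x₁ x₂, HasDerivAt a (a' t) t)
    (hd : ∀ t ∈ Set.Ioo x₁ x₂, HasDerivAt d (d' t) t)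
    (ha0 : ∀ t ∈ Set.Ioo x₁ x₂, a t ≠ 0)
    (hμ : ∀ t ∈ Set.Ioo x₁ x₂, HasDerivAt μ₀ (μ₀' t) t)
    (hμ' : ∀ t ∈ Set.Ioo x₁ x₂, HasDerivAt μ₀' (μ₀'' t) t)
    (hODE : ∀ t ∈ Set.Ioo x₁ x₂,
      μ₀'' t - (a' t / a t - 2 * c t + 4 * d t) * μ₀' t
        + 4 * (a t * b t - c t * d t + (d t) ^ 2 + d t * a' t / (2 * a t) - d' t / 2)
            * μ₀ t = 0)
    (hμ0 : μ₀ t₀ ≠ 0) :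
    ∃ α' : ℝ,
      HasDerivAt (fun t => μ₀' t / (4 * a t * μ₀ t) - d t / (2 * a t)) α' t₀ ∧
      α' + b t₀
          + 2 * c t₀ * (μ₀' t₀ / (4 * a t₀ * μ₀ t₀) - d t₀ / (2 * a t₀))
          + 4 * a t₀ * (μ₀' t₀ / (4 * a t₀ * μ₀ t₀) - d t₀ / (2 * a t₀)) ^ 2 = 0 := by
  have ha₀ := ha0 t₀ ht₀
  have hμ'' : μ₀'' t₀ = (a' t₀ / a t₀ - 2 * c t₀ + 4 * d t₀) * μ₀' t₀
      - 4 * (a t₀ * b t₀ - c t₀ * d t₀ + (d t₀) ^ 2 + d t₀ * a' t₀ / (2 * a t₀) - d' t₀ / 2)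
          * μ₀ t₀ := by
    linear_combination hODE t₀ ht₀
  refine ⟨_, ((hμ' t₀ ht₀).fun_div (((ha t₀ ht₀).const_mul 4).fun_mul (hμ t₀ ht₀))
    (mul_ne_zero (mul_ne_zero four_ne_zero ha₀) hμ0)).fun_sub
    ((hd t₀ ht₀).fun_div ((ha t₀ ht₀).const_mul 2) (mul_ne_zero two_ne_zero ha₀)), ?_⟩
  rw [hμ'']
  field_simp
  ring
end

section
/- Let I ⊆ ℝ be an open interval containing 0, let a, b, c, d : I → ℝ with a continuously differentiable and nonvanishing on I, d differentiable, and b, c continuous; set τ(t) := a'/a − 2c + 4d and σ(t) := ab − cd + d² + d·a'/(2a) − d'/2. Let μ₀, μ₁ : I → ℝ be twice differentiable solutions of μ'' − τ(t)μ' + 4σ(t)μ = 0 with μ₀(0) = 0, μ₀'(0) = 2a(0) ≠ 0, μ₁(0) ≠ 0, μ₁'(0) = 0. Define w(t) := exp(−∫₀ᵗ(c − 2d)ds), β(t) := −w(t)/μ₀(t), and γ(t) := d(0)/(2a(0)) + μ₁(t)/(2μ₁(0)·μ₀(t)). Then at every t₀ ∈ I with μ₀(t₀) ≠ 0, γ'(t₀)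 + a(t₀)·β(t₀)² = 0. -/
open Set intervalIntegral

theorem hasDerivAt_integral_of_continuousOn_Ioo {f : ℝ → ℝ} {x₁ x₂ p t : ℝ}
    (hf : ContinuousOn f (Set.Ioo x₁ x₂)) (hp : p ∈ Set.Ioo x₁ x₂) (ht : t ∈ Set.Ioo x₁ x₂) :
    HasDerivAt (fun u => ∫ s in p..u, f s) (f t) t :=
  integral_hasDerivAt_right
    (hf.mono (Set.ordConnected_Ioo.uIcc_subset hp ht)).intervalIntegrable
    (hf.stronglyMeasurableAtFilter isOpen_Ioo t ht)
    (hf.continuousAt (isOpen_Ioo.mem_nhds ht))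

theorem HasDerivAt.wronskian {u u' v v' : ℝ → ℝ} {u'' v'' t : ℝ}
    (hu : HasDerivAt u (u' t) t) (hu' : HasDerivAt u' u'' t)
    (hv : HasDerivAt v (v' t) t) (hv' : HasDerivAt v' v'' t) :
    HasDerivAt (fun s => v' s * u s - v s * u' s) (v'' * u t - v t * u'') t := by
  refine ((hv'.mul hu).sub (hv.mul hu')).congr_deriv ?_
  ring

theorem eq_of_hasDerivAt_logDeriv_mul {W a a' g P : ℝ → ℝ} {x₁ x₂ p t : ℝ}
    (hp : p ∈ Set.Ioo x₁ x₂) (ht : t ∈ Set.Ioo x₁ x₂)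
    (ha : ∀ s ∈ Set.Ioo x₁ x₂, HasDerivAt a (a' s) s)
    (ha0 : ∀ s ∈ Set.Ioo x₁ x₂, a s ≠ 0)
    (hP : ∀ s ∈ Set.Ioo x₁ x₂, HasDerivAt P (g s) s)
    (hW : ∀ s ∈ Set.Ioo x₁ x₂, HasDerivAt W ((a' s / a s + g s) * W s) s) :
    W t * Real.exp (-P t) / a t = W p * Real.exp (-P p) / a p := by
  have hF : ∀ s ∈ Set.Ioo x₁ x₂,
      HasDerivAt (fun u => W u * Real.exp (-P u) / a u) 0 s := fun s hs => by
    have has := ha0 s hs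
    refine (((hW s hs).mul (hP s hs).fun_neg.exp).div (ha s hs) has).congr_deriv ?_
    simp only [Pi.mul_apply]
    field_simp
    ring
  exact isOpen_Ioo.is_const_of_deriv_eq_zero isPreconnected_Ioo
    (fun s hs => (hF s hs).differentiableAt.differentiableWithinAt)
    (fun s hs => (hF s hs).deriv) ht hp

/-- With `μ₀, μ₁` the fundamental solutions of the characteristic equation,
`w(t) = exp(−∫₀ᵗ (c − 2d))`, `β = −w/μ₀` and
`γ(t) = d(0)/(2a(0)) + μ₁(t)/(2μ₁(0)μ₀(t))`, one has `γ' + aβ² = 0` at every point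
`t₀` of the open interval where `μ₀(t₀) ≠ 0`. -/
theorem gamma_riccati_equation (x₁ x₂ t₀ : ℝ) (h0 : (0 : ℝ) ∈ Set.Ioo x₁ x₂)
    (ht₀ : t₀ ∈ Set.Ioo x₁ x₂)
    (a b c d a' d' μ₀ μ₀' μ₀'' μ₁ μ₁' μ₁'' : ℝ → ℝ)
    (ha : ∀ t ∈ Set.Ioo x₁ x₂, HasDerivAt a (a' t) t)
    (ha'c : ContinuousOn a' (Set.Ioo x₁ x₂))
    (ha0 : ∀ t ∈ Set.Ioo x₁ x₂, a t ≠ 0)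
    (hd : ∀ t ∈ Set.Ioo x₁ x₂, HasDerivAt d (d' t) t)
    (hbc : ContinuousOn b (Set.Ioo x₁ x₂))
    (hcc : ContinuousOn c (Set.Ioo x₁ x₂))
    (hμ₀ : ∀ t ∈ Set.Ioo x₁ x₂, HasDerivAt μ₀ (μ₀' t) t)
    (hμ₀' : ∀ t ∈ Set.Ioo x₁ x₂, HasDerivAt μ₀' (μ₀'' t) t)
    (hμ₁ : ∀ t ∈ Set.Ioo x₁ x₂, HasDerivAt μ₁ (μ₁' t) t)
    (hμ₁' : ∀ t ∈ Set.Ioo x₁ x₂, HasDerivAt μ₁' (μ₁'' t) t)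
    (hODE₀ : ∀ t ∈ Set.Ioo x₁ x₂,
      μ₀'' t - (a' t / a t - 2 * c t + 4 * d t) * μ₀' t
        + 4 * (a t * b t - c t * d t + (d t) ^ 2 + d t * a' t / (2 * a t) - d' t / 2)
            * μ₀ t = 0)
    (hODE₁ : ∀ t ∈ Set.Ioo x₁ x₂,
      μ₁'' t - (a' t / a t - 2 * c t + 4 * d t) * μ₁' t
        + 4 * (a t * b t - c t * d t + (d t) ^ 2 + d t * a' t / (2 * a t) - d' t / 2)
            * μ₁ t = 0)
    (hic₀ : μ₀ 0 = 0) (hic₀' : μ₀' 0 = 2 * a 0) (ha00 : a 0 ≠ 0)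
    (hic₁ : μ₁ 0 ≠ 0) (hic₁' : μ₁' 0 = 0)
    (hμ0t : μ₀ t₀ ≠ 0) :
    ∃ γ' : ℝ,
      HasDerivAt (fun t => d 0 / (2 * a 0) + μ₁ t / (2 * μ₁ 0 * μ₀ t)) γ' t₀ ∧
      γ' + a t₀ *
          (-(Real.exp (-∫ s in (0 : ℝ)..t₀, (c s - 2 * d s))) / μ₀ t₀) ^ 2 = 0 := by
  have hcd : ContinuousOn (fun s => c s - 2 * d s) (Set.Ioo x₁ x₂) :=
    hcc.sub (continuousOn_const.mul fun t ht => (hd t ht).continuousAt.continuousWithinAt)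
  have hP : ∀ t ∈ Set.Ioo x₁ x₂, HasDerivAt
      (fun u => -2 * ∫ s in (0 : ℝ)..u, (c s - 2 * d s)) (-2 * (c t - 2 * d t)) t :=
    fun t ht => (hasDerivAt_integral_of_continuousOn_Ioo hcd h0 ht).const_mul (-2)
  have hW : ∀ t ∈ Set.Ioo x₁ x₂, HasDerivAt (fun s => μ₁' s * μ₀ s - μ₁ s * μ₀' s)
      ((a' t / a t + -2 * (c t - 2 * d t)) * (μ₁' t * μ₀ t - μ₁ t * μ₀' t)) t := by
    intro t ht
    convert (hμ₀ t ht).wronskian (hμ₀' t ht) (hμ₁ t ht) (hμ₁' t ht) using 1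
    linear_combination μ₁ t * hODE₀ t ht - μ₀ t * hODE₁ t ht
  have hconst := eq_of_hasDerivAt_logDeriv_mul h0 ht₀ ha ha0 hP hW
  have hat₀ := ha0 t₀ ht₀
  have hden : 2 * μ₁ 0 * μ₀ t₀ ≠ 0 := mul_ne_zero (mul_ne_zero two_ne_zero hic₁) hμ0t
  refine ⟨_, ((hμ₁ t₀ ht₀).div ((hμ₀ t₀ ht₀).const_mul (2 * μ₁ 0)) hden).const_add _, ?_⟩
  simp only [integral_same, hic₀, hic₀', hic₁', mul_zero, neg_zero, Real.exp_zero] at hconst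
  generalize (∫ s in (0 : ℝ)..t₀, (c s - 2 * d s)) = J at hconst ⊢
  have hexp : Real.exp (2 * J) * Real.exp (-J) ^ 2 = 1 := by
    rw [← Real.exp_nat_mul, ← Real.exp_add]
    norm_num
  have hwronskian : μ₁' t₀ * μ₀ t₀ - μ₁ t₀ * μ₀' t₀
      = -(2 * μ₁ 0) * a t₀ * Real.exp (-J) ^ 2 := by
    field_simp at hconst
    apply mul_right_cancel₀ ha00
    linear_combination Real.exp (-J) ^ 2 * hconst
      - (μ₁' t₀ * μ₀ t₀ - μ₁ t₀ * μ₀' t₀) * a 0 * hexp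
  field_simp
  linear_combination hwronskian
end

section
/- Let I ⊆ ℝ be an open interval, let a, b, c, d, f, g : I → ℝ, and let α, β, γ, δ, ε, κ : I → ℝ be differentiable functions satisfying on all of I the Riccati-type system: α' + b + 2cα + 4aα² = 0; β' + (c + 4aα)β = 0; γ' + aβ² = 0; δ' + (c + 4aα)δ = f + 2αg; ε' = (g − 2aδ)β; κ' = gδ − aδ². Let μ : I → ℝ be differentiable with μ(t) > 0 and μ'(t) = (4a(t)α(t) + 2d(t))·μ(t) on I. Define G : ℝ × ℝ × I → ℂ by G(x,y,t) := e^{−iπ/4}·(2π·μ(t))^{−1/2} · exp( i·(α(t)x² + β(t)xy + γ(t)y² + δ(t)x + ε(t)y + κ(t)) ). Then for every fixed y ∈ ℝ, the function (x,t) ↦ G(x,y,t) satisfies the Schrödinger equation i·∂G/∂t = −a(t)·∂²G/∂x² + b(t)·x²·G − i·c(t)·x·∂G/∂x − i·d(t)·G − f(t)·x·G + i·g(t)·∂G/∂x at every (x,t) ∈ ℝ × I. -/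
open Complex Set

/-- The Green function (Feynman propagator) of the quadratic-Hamiltonian Schrödinger
equation: `G(x,y,t) = e^{-iπ/4}(2πμ(t))^{-1/2} exp(i(αx² + βxy + γy² + δx + εy + κ))`. -/
noncomputable def greenFn (α β γ δ ε κ μ : ℝ → ℝ) (x y t : ℝ) : ℂ :=
  Complex.exp (-(Complex.I * (Real.pi : ℂ) / 4)) * ((Real.sqrt (2 * Real.pi * μ t) : ℝ) : ℂ)⁻¹ *
    Complex.exp (Complex.I *
      ((α t * x ^ 2 + β t * x * y + γ t * y ^ 2 + δ t * x + ε t * y + κ t : ℝ) : ℂ))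

/-- The spatial derivative of the Green function is `i ∂ₓS · G`, with `S` its phase. -/
lemma hasDerivAt_greenFn_space (α β γ δ ε κ μ : ℝ → ℝ) (x y t : ℝ) :
    HasDerivAt (fun ξ : ℝ => greenFn α β γ δ ε κ μ ξ y t)
      (Complex.I * ((2 * α t * x + β t * y + δ t : ℝ) : ℂ) * greenFn α β γ δ ε κ μ x y t) x := by
  have hS : HasDerivAt
      (fun ξ : ℝ => α t * ξ ^ 2 + β t * ξ * y + γ t * y ^ 2 + δ t * ξ + ε t * y + κ t)
      (2 * α t * x + β t * y + δ t) x := by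
    have h := (((((((hasDerivAt_id x).pow 2).const_mul (α t)).add
      (((hasDerivAt_id x).const_mul (β t)).mul_const y)).add_const (γ t * y ^ 2)).add
      ((hasDerivAt_id x).const_mul (δ t))).add_const (ε t * y)).add_const (κ t)
    refine h.congr_deriv ?_
    simp
    ring
  refine (((hS.ofReal_comp.const_mul Complex.I).cexp).const_mul
    (Complex.exp (-(Complex.I * (Real.pi : ℂ) / 4)) *
      ((Real.sqrt (2 * Real.pi * μ t) : ℝ) : ℂ)⁻¹)).congr_deriv ?_
  unfold greenFn
  ring

/-- The second spatial derivative of the Green function is `(2iα - (∂ₓS)²) · G`. -/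
lemma iteratedDeriv_two_greenFn_space (α β γ δ ε κ μ : ℝ → ℝ) (x y t : ℝ) :
    iteratedDeriv 2 (fun ξ : ℝ => greenFn α β γ δ ε κ μ ξ y t) x =
      (2 * Complex.I * (α t : ℂ) - ((2 * α t * x + β t * y + δ t : ℝ) : ℂ) ^ 2) *
        greenFn α β γ δ ε κ μ x y t := by
  have hderiv : deriv (fun ξ : ℝ => greenFn α β γ δ ε κ μ ξ y t) = fun ξ : ℝ =>
      Complex.I * ((2 * α t * ξ + β t * y + δ t : ℝ) : ℂ) * greenFn α β γ δ ε κ μ ξ y t :=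
    funext fun ξ => (hasDerivAt_greenFn_space α β γ δ ε κ μ ξ y t).deriv
  have hSx : HasDerivAt (fun ξ : ℝ => 2 * α t * ξ + β t * y + δ t) (2 * α t) x := by
    simpa using (((hasDerivAt_id x).const_mul (2 * α t)).add_const (β t * y)).add_const (δ t)
  rw [iteratedDeriv_succ, iteratedDeriv_one, hderiv]
  refine (((hSx.ofReal_comp.const_mul Complex.I).mul
    (hasDerivAt_greenFn_space α β γ δ ε κ μ x y t)).congr_deriv ?_).deriv
  push_cast
  linear_combination (2 * (α t : ℂ) * x + β t * y + δ t) ^ 2 *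
    greenFn α β γ δ ε κ μ x y t * Complex.I_sq

/-- The time derivative of the Green function is `(i ∂ₜS - m / 2) · G`, where `m = μ' / μ`. -/
lemma hasDerivAt_greenFn_time {α β γ δ ε κ μ : ℝ → ℝ} {α' β' γ' δ' ε' κ' m t : ℝ}
    (hα : HasDerivAt α α' t) (hβ : HasDerivAt β β' t) (hγ : HasDerivAt γ γ' t)
    (hδ : HasDerivAt δ δ' t) (hε : HasDerivAt ε ε' t) (hκ : HasDerivAt κ κ' t)
    (hμpos : 0 < μ t) (hμ : HasDerivAt μ (m * μ t) t) (x y : ℝ) :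
    HasDerivAt (fun τ : ℝ => greenFn α β γ δ ε κ μ x y τ)
      ((Complex.I *
          ((α' * x ^ 2 + β' * x * y + γ' * y ^ 2 + δ' * x + ε' * y + κ' : ℝ) : ℂ) - m / 2) *
        greenFn α β γ δ ε κ μ x y t) t := by
  have hS : HasDerivAt
      (fun τ : ℝ => α τ * x ^ 2 + β τ * x * y + γ τ * y ^ 2 + δ τ * x + ε τ * y + κ τ)
      (α' * x ^ 2 + β' * x * y + γ' * y ^ 2 + δ' * x + ε' * y + κ') t :=
    (((((hα.mul_const _).add ((hβ.mul_const x).mul_const y)).add (hγ.mul_const _)).add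
      (hδ.mul_const x)).add (hε.mul_const y)).add hκ
  have hpos : 0 < 2 * Real.pi * μ t := by positivity
  have hr : HasDerivAt (fun τ : ℝ => (Real.sqrt (2 * Real.pi * μ τ))⁻¹)
      (-(m / 2) * (Real.sqrt (2 * Real.pi * μ t))⁻¹) t := by
    have hs := Real.sqrt_pos.mpr hpos
    refine (((hμ.const_mul (2 * Real.pi)).sqrt hpos.ne').inv hs.ne').congr_deriv ?_
    rw [show 2 * Real.pi * (m * μ t) = m * Real.sqrt (2 * Real.pi * μ t) ^ 2 by
      rw [Real.sq_sqrt hpos.le]; ring]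
    field_simp
  have hrC : HasDerivAt (fun τ : ℝ => ((Real.sqrt (2 * Real.pi * μ τ) : ℝ) : ℂ)⁻¹)
      (-(m / 2) * ((Real.sqrt (2 * Real.pi * μ t) : ℝ) : ℂ)⁻¹) t := by
    simpa using hr.ofReal_comp
  refine ((hrC.const_mul (Complex.exp (-(Complex.I * (Real.pi : ℂ) / 4)))).mul
    (hS.ofReal_comp.const_mul Complex.I).cexp).congr_deriv ?_
  unfold greenFn
  ring

/-- If `(α,β,γ,δ,ε,κ)` solve the Riccati-type system on an open set
`I` and `μ > 0` satisfies `μ' = (4aα + 2d)μ`, then for every fixed `y`, the Green function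
`G(x,y,t)` satisfies the Schrödinger equation
`i∂ₜG = −a∂ₓ²G + bx²G − icx∂ₓG − idG − fxG + ig∂ₓG` at every `(x,t) ∈ ℝ × I`. -/
theorem green_function_solves_schrodinger
    (I : Set ℝ) (hI : IsOpen I)
    (a b c d f g α β γ δ ε κ μ α' β' γ' δ' ε' κ' : ℝ → ℝ)
    (hα : ∀ t ∈ I, HasDerivAt α (α' t) t)
    (hβ : ∀ t ∈ I, HasDerivAt β (β' t) t)
    (hγ : ∀ t ∈ I, HasDerivAt γ (γ' t) t)
    (hδ : ∀ t ∈ I, HasDerivAt δ (δ' t) t)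
    (hε : ∀ t ∈ I, HasDerivAt ε (ε' t) t)
    (hκ : ∀ t ∈ I, HasDerivAt κ (κ' t) t)
    (hric1 : ∀ t ∈ I, α' t + b t + 2 * c t * α t + 4 * a t * (α t) ^ 2 = 0)
    (hric2 : ∀ t ∈ I, β' t + (c t + 4 * a t * α t) * β t = 0)
    (hric3 : ∀ t ∈ I, γ' t + a t * (β t) ^ 2 = 0)
    (hric4 : ∀ t ∈ I, δ' t + (c t + 4 * a t * α t) * δ t = f t + 2 * α t * g t)
    (hric5 : ∀ t ∈ I, ε' t = (g t - 2 * a t * δ t) * β t)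
    (hric6 : ∀ t ∈ I, κ' t = g t * δ t - a t * (δ t) ^ 2)
    (hμpos : ∀ t ∈ I, 0 < μ t)
    (hμ : ∀ t ∈ I, HasDerivAt μ ((4 * a t * α t + 2 * d t) * μ t) t) :
    ∀ y x : ℝ, ∀ t ∈ I,
      Complex.I * deriv (fun τ : ℝ => greenFn α β γ δ ε κ μ x y τ) t
        = -(a t : ℂ) * iteratedDeriv 2 (fun ξ : ℝ => greenFn α β γ δ ε κ μ ξ y t) x
          + (b t : ℂ) * (x : ℂ) ^ 2 * greenFn α β γ δ ε κ μ x y t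
          - Complex.I * (c t : ℂ) * (x : ℂ) *
              deriv (fun ξ : ℝ => greenFn α β γ δ ε κ μ ξ y t) x
          - Complex.I * (d t : ℂ) * greenFn α β γ δ ε κ μ x y t
          - (f t : ℂ) * (x : ℂ) * greenFn α β γ δ ε κ μ x y t
          + Complex.I * (g t : ℂ) *
              deriv (fun ξ : ℝ => greenFn α β γ δ ε κ μ ξ y t) x := by
  intro y x t ht
  rw [(hasDerivAt_greenFn_time (hα t ht) (hβ t ht) (hγ t ht) (hδ t ht) (hε t ht) (hκ t ht)
      (hμpos t ht) (hμ t ht) x y).deriv,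
    iteratedDeriv_two_greenFn_space, (hasDerivAt_greenFn_space α β γ δ ε κ μ x y t).deriv]
  have hamiltonJacobi :
      α' t * x ^ 2 + β' t * x * y + γ' t * y ^ 2 + δ' t * x + ε' t * y + κ' t =
        -(a t * (2 * α t * x + β t * y + δ t) ^ 2 + b t * x ^ 2
          + c t * x * (2 * α t * x + β t * y + δ t) - f t * x
          - g t * (2 * α t * x + β t * y + δ t)) := by
    linear_combination x ^ 2 * hric1 t ht + x * y * hric2 t ht + y ^ 2 * hric3 t ht
      + x * hric4 t ht + y * hric5 t ht + hric6 t ht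
  rw [hamiltonJacobi]
  generalize greenFn α β γ δ ε κ μ x y t = G
  push_cast
  ring_nf
  simp only [Complex.I_sq]
  ring
end

section
/- Let I ⊆ ℝ be an open interval, let a, b, c, d, f, g : I → ℝ, and let α, β, γ, δ, ε, κ : I → ℝ be differentiable functions satisfying on I the Riccati-type system: α' + b + 2cα + 4aα² = 0; β' + (c + 4aα)β = 0; γ' + aβ² = 0; δ' + (c + 4aα)δ = f + 2αg; ε' = (g − 2aδ)β; κ' = gδ − aδ². Let μ : I → ℝ be differentiable with μ'(t) = (4a(t)α(t) + 2d(t))·μ(t) and μ(t)·γ(t) > 0 on I. For a real parameter h define φ_h : ℝ × I → ℂ by φ_h(x,t) := (2·μ(t)·γ(t))^{−1/2} · exp( i·[ α(t)x² + δ(t)x + κ(t) − (β(t)x + ε(t) + h)²/(4γ(t)) ] ). Then φ_h satisfies the Schrödinger equation i·∂φ_h/∂t = −a(t)·∂²φ_h/∂x² + b(t)·x²·φ_h − i·c(t)·x·∂φ_h/∂x − i·d(t)·φ_h − f(t)·x·φ_h + i·g(t)·∂φ_h/∂x at every (x,t) ∈ ℝ × I. -/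
open Complex Set

/-- The plane-wave solution of the quadratic-Hamiltonian Schrödinger equation:
`φ_h(x,t) = (2μγ)^{-1/2} exp(i[αx² + δx + κ − (βx + ε + h)²/(4γ)])`. -/
noncomputable def planeWaveSol (α β γ δ ε κ μ : ℝ → ℝ) (h x t : ℝ) : ℂ :=
  ((Real.sqrt (2 * μ t * γ t) : ℝ) : ℂ)⁻¹ *
    Complex.exp (Complex.I *
      ((α t * x ^ 2 + δ t * x + κ t - (β t * x + ε t + h) ^ 2 / (4 * γ t) : ℝ) : ℂ))

/-- The derivative of an amplitude-phase product `A · exp (i S)`. -/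
theorem hasDerivAt_ofReal_mul_exp_I_mul {A S : ℝ → ℝ} {A' S' t : ℝ}
    (hA : HasDerivAt A A' t) (hS : HasDerivAt S S' t) :
    HasDerivAt (fun τ => (A τ : ℂ) * Complex.exp (Complex.I * (S τ : ℂ)))
      (((A' : ℂ) + Complex.I * S' * A t) * Complex.exp (Complex.I * (S t : ℂ))) t :=
  (hA.ofReal_comp.mul (hS.ofReal_comp.const_mul Complex.I).cexp).congr_deriv (by ring)

/-- The derivative of the inverse square root of twice a positive function. -/
theorem hasDerivAt_inv_sqrt_two_mul {m : ℝ → ℝ} {m' t : ℝ}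
    (hm : HasDerivAt m m' t) (hpos : 0 < m t) :
    HasDerivAt (fun τ => (Real.sqrt (2 * m τ))⁻¹)
      (-(m' / (2 * m t)) * (Real.sqrt (2 * m t))⁻¹) t := by
  have hpos2 : 0 < 2 * m t := by positivity
  have hsq : Real.sqrt (2 * m t) ^ 2 = 2 * m t := Real.sq_sqrt hpos2.le
  have hne : Real.sqrt (2 * m t) ≠ 0 := (Real.sqrt_pos.2 hpos2).ne'
  refine (((hm.const_mul 2).sqrt hpos2.ne').fun_inv hne).congr_deriv ?_
  rw [hsq]
  field_simp

theorem hasDerivAt_planeWaveSol_space (α β γ δ ε κ μ : ℝ → ℝ) (h x t : ℝ) :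
    HasDerivAt (fun ξ : ℝ => planeWaveSol α β γ δ ε κ μ h ξ t)
      (Complex.I * ((2 * α t * x + δ t - β t * (β t * x + ε t + h) / (2 * γ t) : ℝ) : ℂ) *
        planeWaveSol α β γ δ ε κ μ h x t) x := by
  have hid := hasDerivAt_id' x
  have hS : HasDerivAt (fun ξ : ℝ =>
      α t * ξ ^ 2 + δ t * ξ + κ t - (β t * ξ + ε t + h) ^ 2 / (4 * γ t))
      (2 * α t * x + δ t - β t * (β t * x + ε t + h) / (2 * γ t)) x := by
    refine ((((hid.fun_pow 2).const_mul (α t)).fun_add (hid.const_mul (δ t))).add_const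
      (κ t) |>.fun_sub (((((hid.const_mul (β t)).add_const (ε t)).add_const h).fun_pow 2).div_const
      (4 * γ t))).congr_deriv ?_
    push_cast
    ring
  have key := hasDerivAt_ofReal_mul_exp_I_mul
    (hasDerivAt_const x (Real.sqrt (2 * μ t * γ t))⁻¹) hS
  simp only [Complex.ofReal_inv] at key
  refine key.congr_deriv ?_
  rw [planeWaveSol, Complex.ofReal_zero]
  ring

theorem iteratedDeriv_two_planeWaveSol_space (α β γ δ ε κ μ : ℝ → ℝ) (h x t : ℝ) :
    iteratedDeriv 2 (fun ξ : ℝ => planeWaveSol α β γ δ ε κ μ h ξ t) x =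
      (Complex.I * ((2 * α t - β t ^ 2 / (2 * γ t) : ℝ) : ℂ) -
        ((2 * α t * x + δ t - β t * (β t * x + ε t + h) / (2 * γ t) : ℝ) : ℂ) ^ 2) *
        planeWaveSol α β γ δ ε κ μ h x t := by
  have hid := hasDerivAt_id' x
  have hS' : HasDerivAt (fun ξ : ℝ =>
      2 * α t * ξ + δ t - β t * (β t * ξ + ε t + h) / (2 * γ t))
      (2 * α t - β t ^ 2 / (2 * γ t)) x := by
    refine (((hid.const_mul (2 * α t)).add_const (δ t)).fun_sub
      (((((hid.const_mul (β t)).add_const (ε t)).add_const h).const_mul (β t)).div_const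
      (2 * γ t))).congr_deriv ?_
    ring
  have hfirst : deriv (fun ξ : ℝ => planeWaveSol α β γ δ ε κ μ h ξ t) = fun ξ : ℝ =>
      Complex.I * ((2 * α t * ξ + δ t - β t * (β t * ξ + ε t + h) / (2 * γ t) : ℝ) : ℂ) *
        planeWaveSol α β γ δ ε κ μ h ξ t :=
    funext fun ξ => (hasDerivAt_planeWaveSol_space α β γ δ ε κ μ h ξ t).deriv
  rw [iteratedDeriv_succ, iteratedDeriv_one, hfirst,
    ((hS'.ofReal_comp.const_mul Complex.I).fun_mul
      (hasDerivAt_planeWaveSol_space α β γ δ ε κ μ h x t)).deriv]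
  linear_combination
    ((2 * α t * x + δ t - β t * (β t * x + ε t + h) / (2 * γ t) : ℝ) : ℂ) ^ 2 *
      planeWaveSol α β γ δ ε κ μ h x t * Complex.I_sq

theorem hasDerivAt_planeWaveSol_time {α β γ δ ε κ μ : ℝ → ℝ} {t α' β' γ' δ' ε' κ' μ' : ℝ}
    (hα : HasDerivAt α α' t) (hβ : HasDerivAt β β' t) (hγ : HasDerivAt γ γ' t)
    (hδ : HasDerivAt δ δ' t) (hε : HasDerivAt ε ε' t) (hκ : HasDerivAt κ κ' t)
    (hμ : HasDerivAt μ μ' t) (hμγ : 0 < μ t * γ t) (h x : ℝ) :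
    HasDerivAt (fun τ : ℝ => planeWaveSol α β γ δ ε κ μ h x τ)
      ((((-((μ' * γ t + μ t * γ') / (2 * (μ t * γ t))) : ℝ) : ℂ) +
        Complex.I * ((α' * x ^ 2 + δ' * x + κ' -
          (β t * x + ε t + h) * (β' * x + ε') / (2 * γ t) +
          (β t * x + ε t + h) ^ 2 * γ' / (4 * γ t ^ 2) : ℝ) : ℂ)) *
        planeWaveSol α β γ δ ε κ μ h x t) t := by
  have hγ0 : γ t ≠ 0 := right_ne_zero_of_mul hμγ.ne'
  have hS : HasDerivAt (fun τ : ℝ =>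
      α τ * x ^ 2 + δ τ * x + κ τ - (β τ * x + ε τ + h) ^ 2 / (4 * γ τ))
      (α' * x ^ 2 + δ' * x + κ' - (β t * x + ε t + h) * (β' * x + ε') / (2 * γ t) +
        (β t * x + ε t + h) ^ 2 * γ' / (4 * γ t ^ 2)) t := by
    refine ((((hα.mul_const (x ^ 2)).fun_add (hδ.mul_const x)).fun_add hκ).fun_sub
      (((((hβ.mul_const x).fun_add hε).add_const h).fun_pow 2).fun_div (hγ.const_mul 4)
      (mul_ne_zero four_ne_zero hγ0))).congr_deriv ?_
    push_cast
    field_simp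
    ring
  have key := hasDerivAt_ofReal_mul_exp_I_mul
    (hasDerivAt_inv_sqrt_two_mul (hμ.fun_mul hγ) hμγ) hS
  simp only [← mul_assoc (2 : ℝ), Complex.ofReal_mul _ (_⁻¹), Complex.ofReal_inv (Real.sqrt _)]
    at key
  refine key.congr_deriv ?_
  rw [planeWaveSol, mul_assoc (2 : ℝ)]
  ring

/-- If `(α,β,γ,δ,ε,κ)` solve the Riccati-type system on an open set `I`,
and `μ` satisfies `μ' = (4aα + 2d)μ` with `μγ > 0`, then `φ_h` satisfies the Schrödinger
equation `i∂ₜφ = −a∂ₓ²φ + bx²φ − icx∂ₓφ − idφ − fxφ + ig∂ₓφ` at every `(x,t) ∈ ℝ × I`. -/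
theorem plane_wave_solution_solves_schrodinger
    (I : Set ℝ) (hI : IsOpen I)
    (a b c d f g α β γ δ ε κ μ α' β' γ' δ' ε' κ' : ℝ → ℝ) (h : ℝ)
    (hα : ∀ t ∈ I, HasDerivAt α (α' t) t)
    (hβ : ∀ t ∈ I, HasDerivAt β (β' t) t)
    (hγ : ∀ t ∈ I, HasDerivAt γ (γ' t) t)
    (hδ : ∀ t ∈ I, HasDerivAt δ (δ' t) t)
    (hε : ∀ t ∈ I, HasDerivAt ε (ε' t) t)
    (hκ : ∀ t ∈ I, HasDerivAt κ (κ' t) t)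
    (hric1 : ∀ t ∈ I, α' t + b t + 2 * c t * α t + 4 * a t * (α t) ^ 2 = 0)
    (hric2 : ∀ t ∈ I, β' t + (c t + 4 * a t * α t) * β t = 0)
    (hric3 : ∀ t ∈ I, γ' t + a t * (β t) ^ 2 = 0)
    (hric4 : ∀ t ∈ I, δ' t + (c t + 4 * a t * α t) * δ t = f t + 2 * α t * g t)
    (hric5 : ∀ t ∈ I, ε' t = (g t - 2 * a t * δ t) * β t)
    (hric6 : ∀ t ∈ I, κ' t = g t * δ t - a t * (δ t) ^ 2)
    (hμ : ∀ t ∈ I, HasDerivAt μ ((4 * a t * α t + 2 * d t) * μ t) t)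
    (hμγ : ∀ t ∈ I, 0 < μ t * γ t) :
    ∀ x : ℝ, ∀ t ∈ I,
      Complex.I * deriv (fun τ : ℝ => planeWaveSol α β γ δ ε κ μ h x τ) t
        = -(a t : ℂ) * iteratedDeriv 2 (fun ξ : ℝ => planeWaveSol α β γ δ ε κ μ h ξ t) x
          + (b t : ℂ) * (x : ℂ) ^ 2 * planeWaveSol α β γ δ ε κ μ h x t
          - Complex.I * (c t : ℂ) * (x : ℂ) *
              deriv (fun ξ : ℝ => planeWaveSol α β γ δ ε κ μ h ξ t) x
          - Complex.I * (d t : ℂ) * planeWaveSol α β γ δ ε κ μ h x t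
          - (f t : ℂ) * (x : ℂ) * planeWaveSol α β γ δ ε κ μ h x t
          + Complex.I * (g t : ℂ) *
              deriv (fun ξ : ℝ => planeWaveSol α β γ δ ε κ μ h ξ t) x := by
  intro x t ht
  have hprod := hμγ t ht
  have hγ0 : γ t ≠ 0 := right_ne_zero_of_mul hprod.ne'
  have hμ0 : μ t ≠ 0 := left_ne_zero_of_mul hprod.ne'
  rw [(hasDerivAt_planeWaveSol_time (hα t ht) (hβ t ht) (hγ t ht) (hδ t ht) (hε t ht) (hκ t ht)
      (hμ t ht) hprod h x).deriv, (hasDerivAt_planeWaveSol_space α β γ δ ε κ μ h x t).deriv,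
    iteratedDeriv_two_planeWaveSol_space]
  set p : ℝ := 2 * α t * x + δ t - β t * (β t * x + ε t + h) / (2 * γ t) with hp
  set q : ℝ := 2 * α t - β t ^ 2 / (2 * γ t) with hq
  have hamp : -(((4 * a t * α t + 2 * d t) * μ t * γ t + μ t * γ' t) / (2 * (μ t * γ t))) =
      -(a t * q) - d t := by
    rw [hq, eq_neg_of_add_eq_zero_left (hric3 t ht)]
    field_simp
    ring
  have hphase : α' t * x ^ 2 + δ' t * x + κ' t -
      (β t * x + ε t + h) * (β' t * x + ε' t) / (2 * γ t) +
      (β t * x + ε t + h) ^ 2 * γ' t / (4 * γ t ^ 2) =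
      -(a t * p ^ 2 + b t * x ^ 2 + c t * x * p - f t * x - g t * p) := by
    rw [hp, hric5 t ht, hric6 t ht, eq_neg_of_add_eq_zero_left (hric2 t ht),
      eq_neg_of_add_eq_zero_left (hric3 t ht), eq_sub_of_add_eq (hric4 t ht),
      show α' t = -(b t + 2 * c t * α t + 4 * a t * α t ^ 2) by linarith [hric1 t ht]]
    field_simp
    ring
  rw [hamp, hphase]
  push_cast
  linear_combination planeWaveSol α β γ δ ε κ μ h x t *
    (-(a t * p ^ 2 + b t * x ^ 2 + c t * x * p - f t * x - g t * p) +
      c t * x * p - g t * p) * Complex.I_sq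
end

section
/- Let α, β, γ, δ, ε, κ, μ be real numbers with γ ≠ 0 and μ·γ > 0, and fix a real number x. For a real parameter s define Φ(s) := (2μγ)^{−1/2} · exp( i·[ αx² + δx + κ − (βx + ε + s)²/(4γ) ] ). Then for every real h > 1, lim_{n→∞} ∑_{k=0}^{n} C_k(n,h) · Φ(1 − 2k/n) = Φ(h). In other words, superoscillations persist: the solution of the Schrödinger equation with superoscillating initial datum F_n converges, as n → ∞, to the solution with datum e^{ihx}. -/
open Complex Filter Finset

/-- The closed-form value at a fixed space-time point of the solution of the
quadratic-Hamiltonian Schrödinger equation with plane-wave datum `e^{isx}`. -/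
noncomputable def PhiVal (α β γ δ ε κ μ x s : ℝ) : ℂ :=
  ((Real.sqrt (2 * μ * γ) : ℝ) : ℂ)⁻¹ *
    Complex.exp (Complex.I *
      ((α * x ^ 2 + δ * x + κ - (β * x + ε + s) ^ 2 / (4 * γ) : ℝ) : ℂ))

/-- The mixed moments `E[(K / n) ^ m * (K.choose j)] / (n.choose j)` of the (complex) binomial
distribution with parameters `n` and `p`, given by their recursion in `m`. -/
noncomputable def bernsteinMoment (n : ℕ) (p : ℂ) : ℕ → ℕ → ℂ
  | 0, j => p ^ j
  | m + 1, j => (n - j) / n * bernsteinMoment n p m (j + 1) + j / n * bernsteinMoment n p m j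

theorem sum_binomial_choose (n j : ℕ) (p : ℂ) :
    ∑ k ∈ range (n + 1), (n.choose k * p ^ k * (1 - p) ^ (n - k)) * (k.choose j : ℂ) =
      n.choose j * p ^ j := by
  rcases lt_or_ge n j with hj | hj
  · rw [Nat.choose_eq_zero_of_lt hj]
    simp only [Nat.cast_zero, zero_mul]
    refine sum_eq_zero fun k hk => ?_
    rw [Nat.choose_eq_zero_of_lt (n := k) (by have := mem_range.1 hk; omega)]
    simp
  · obtain ⟨r, rfl⟩ := Nat.exists_eq_add_of_le hj
    have hlow : ∑ k ∈ range j, ((j + r).choose k * p ^ k * (1 - p) ^ (j + r - k)) *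
        (k.choose j : ℂ) = 0 := by
      refine sum_eq_zero fun k hk => ?_
      rw [Nat.choose_eq_zero_of_lt (mem_range.1 hk)]
      simp
    have hone : ∑ i ∈ range (r + 1), p ^ i * (1 - p) ^ (r - i) * (r.choose i : ℂ) = 1 := by
      rw [← add_pow]
      simp
    rw [add_assoc, sum_range_add, hlow, zero_add]
    refine Eq.trans ?_ ((congrArg (((j + r).choose j * p ^ j : ℂ) * ·) hone).trans (mul_one _))
    rw [mul_sum]
    refine sum_congr rfl fun i hi => ?_
    have hir : i ≤ r := by have := mem_range.1 hi; omega
    have hc : ((j + r).choose (j + i) : ℂ) * ((j + i).choose j : ℂ) =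
        (j + r).choose j * r.choose i := by
      have := Nat.choose_mul (n := j + r) (k := j + i) (s := j) (Nat.le_add_right j i)
      rw [Nat.add_sub_cancel_left, Nat.add_sub_cancel_left] at this
      exact_mod_cast this
    rw [Nat.add_sub_add_left, pow_add]
    linear_combination p ^ j * p ^ i * (1 - p) ^ (r - i) * hc

theorem sum_binomial_pow_choose (n m j : ℕ) (p : ℂ) :
    ∑ k ∈ range (n + 1), (n.choose k * p ^ k * (1 - p) ^ (n - k)) *
      ((k / n : ℂ) ^ m * (k.choose j : ℂ)) = n.choose j * bernsteinMoment n p m j := by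
  have hrec (j a : ℕ) : ((a.choose (j + 1) : ℕ) : ℂ) * (j + 1) = a.choose j * (a - j) := by
    rcases le_or_gt j a with h | h
    · have := Nat.choose_succ_right_eq a j
      rw [← Nat.cast_sub h]
      exact_mod_cast this
    · simp [Nat.choose_eq_zero_of_lt h, Nat.choose_eq_zero_of_lt (Nat.lt_succ_of_lt h)]
  induction m generalizing j with
  | zero => simpa [bernsteinMoment] using sum_binomial_choose n j p
  | succ m ih =>
    have key : ∑ k ∈ range (n + 1), (n.choose k * p ^ k * (1 - p) ^ (n - k)) *
        ((k / n : ℂ) ^ (m + 1) * (k.choose j : ℂ)) =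
        (j + 1) / n * (n.choose (j + 1) * bernsteinMoment n p m (j + 1)) +
          j / n * (n.choose j * bernsteinMoment n p m j) := by
      rw [← ih, ← ih, mul_sum, mul_sum, ← sum_add_distrib]
      refine sum_congr rfl fun k _ => ?_
      rw [pow_succ]
      linear_combination
        (-(n.choose k * p ^ k * (1 - p) ^ (n - k)) * (k / n : ℂ) ^ m / n) * hrec j k
    rw [key, bernsteinMoment]
    linear_combination (bernsteinMoment n p m (j + 1) / n) * hrec j n

theorem norm_bernsteinMoment_le {n : ℕ} {p : ℂ} {R : ℝ} (hR : 1 ≤ R) (hp : ‖p‖ ≤ R)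
    (hn : n ≠ 0) (m : ℕ) {j : ℕ} (hj : j ≤ n) : ‖bernsteinMoment n p m j‖ ≤ R ^ (m + j) := by
  induction m generalizing j with
  | zero => simpa [bernsteinMoment] using pow_le_pow_left₀ (norm_nonneg p) hp j
  | succ m ih =>
    have hn' : (0 : ℝ) < n := by positivity
    have hR0 : 0 ≤ R := zero_le_one.trans hR
    have hfirst : ‖((n : ℂ) - j) / n * bernsteinMoment n p m (j + 1)‖ ≤
        ((n : ℝ) - j) / n * R ^ (m + 1 + j) := by
      rcases hj.eq_or_lt with rfl | hlt
      · simp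
      · rw [norm_mul, norm_div, ← Nat.cast_sub hj, Complex.norm_natCast, Complex.norm_natCast,
          Nat.cast_sub hj, add_right_comm, add_assoc]
        have : (0 : ℝ) ≤ n - j := sub_nonneg.2 (by exact_mod_cast hj)
        gcongr
        exact ih hlt
    have hsecond : ‖(j : ℂ) / n * bernsteinMoment n p m j‖ ≤ (j : ℝ) / n * R ^ (m + 1 + j) := by
      rw [norm_mul, norm_div, Complex.norm_natCast, Complex.norm_natCast]
      gcongr
      exact (ih hj).trans (pow_le_pow_right₀ hR (by omega))
    calc ‖bernsteinMoment n p (m + 1) j‖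
        ≤ ((n : ℝ) - j) / n * R ^ (m + 1 + j) + (j : ℝ) / n * R ^ (m + 1 + j) :=
          (norm_add_le _ _).trans (add_le_add hfirst hsecond)
      _ = R ^ (m + 1 + j) := by field_simp; ring

theorem tendsto_bernsteinMoment (p : ℂ) (m j : ℕ) :
    Tendsto (fun n : ℕ => bernsteinMoment n p m j) atTop (nhds (p ^ (m + j))) := by
  induction m generalizing j with
  | zero => simp [bernsteinMoment]
  | succ m ih =>
    have hdiv : Tendsto (fun n : ℕ => (j : ℂ) / n) atTop (nhds 0) :=
      tendsto_const_div_atTop_nhds_zero_nat (j : ℂ)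
    have hsub : Tendsto (fun n : ℕ => ((n : ℂ) - j) / n) atTop (nhds 1) := by
      have := hdiv.const_sub 1
      rw [sub_zero] at this
      refine this.congr' ?_
      filter_upwards [eventually_ne_atTop 0] with n hn
      have : (n : ℂ) ≠ 0 := Nat.cast_ne_zero.2 hn
      field_simp
    have := (hsub.mul (ih (j + 1))).add (hdiv.mul (ih j))
    rw [one_mul, zero_mul, add_zero] at this
    rwa [add_right_comm, add_assoc]

/-- The Bernstein polynomials of an entire function converge to it on the whole complex plane. -/
theorem tendsto_bernstein_of_entire {F : ℂ → ℂ} (hF : Differentiable ℂ F) (p : ℂ) :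
    Tendsto (fun n : ℕ => ∑ k ∈ range (n + 1),
      (n.choose k * p ^ k * (1 - p) ^ (n - k)) * F (k / n)) atTop (nhds (F p)) := by
  obtain ⟨a, ha⟩ : ∃ a : ℕ → ℂ, ∀ z, HasSum (fun m => a m * z ^ m) (F z) := by
    refine ⟨fun m => (m.factorial : ℂ)⁻¹ * iteratedDeriv m F 0, fun z => ?_⟩
    refine (Complex.hasSum_taylorSeries_of_entire hF 0 z).congr_fun fun m => ?_
    simp only [sub_zero, smul_eq_mul]
    ring
  set R : ℝ := max 1 ‖p‖
  have hR : 1 ≤ R := le_max_left _ _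
  have hsum : Summable fun m => ‖a m‖ * R ^ m := by
    have := (ha R).summable.norm
    simpa [abs_of_nonneg (zero_le_one.trans hR)] using this
  have hlim : Tendsto (fun n : ℕ => ∑' m, a m * bernsteinMoment n p m 0) atTop
      (nhds (∑' m, a m * p ^ m)) := by
    refine tendsto_tsum_of_dominated_convergence hsum
      (fun m => (tendsto_bernsteinMoment p m 0).const_mul (a m)) ?_
    filter_upwards [eventually_ne_atTop 0] with n hn m
    rw [norm_mul]
    gcongr
    exact norm_bernsteinMoment_le hR (le_max_right _ _) hn m n.zero_le
  rw [(ha p).tsum_eq] at hlim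
  refine hlim.congr' ?_
  filter_upwards [eventually_ne_atTop 0] with n hn
  have hs : HasSum (fun m => ∑ k ∈ range (n + 1),
      (n.choose k * p ^ k * (1 - p) ^ (n - k)) * (a m * (k / n : ℂ) ^ m))
      (∑ k ∈ range (n + 1), (n.choose k * p ^ k * (1 - p) ^ (n - k)) * F (k / n)) :=
    hasSum_sum fun k _ => (ha (k / n)).mul_left _
  rw [← hs.tsum_eq]
  refine tsum_congr fun m => ?_
  have := sum_binomial_pow_choose n m 0 p
  simp only [Nat.choose_zero_right, Nat.cast_one, mul_one, one_mul] at this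
  rw [← this, mul_sum]
  exact sum_congr rfl fun k _ => by ring

/-- Persistence of superoscillations: for `h > 1`,
`∑_{k=0}^{n} C_k(n,h) Φ(1 − 2k/n) → Φ(h)` as `n → ∞`. -/
theorem superoscillation_persistence
    (α β γ δ ε κ μ x : ℝ) (hγ : γ ≠ 0) (hμγ : 0 < μ * γ) (h : ℝ) (hh : 1 < h) :
    Filter.Tendsto
      (fun n : ℕ => ∑ k ∈ Finset.range (n + 1),
        (supC n k h : ℂ) * PhiVal α β γ δ ε κ μ x (1 - 2 * k / n))
      Filter.atTop (nhds (PhiVal α β γ δ ε κ μ x h)) := by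
  set F : ℂ → ℂ := fun t => ((Real.sqrt (2 * μ * γ) : ℝ) : ℂ)⁻¹ *
    Complex.exp (Complex.I *
      (α * x ^ 2 + δ * x + κ - (β * x + ε + (1 - 2 * t)) ^ 2 / (4 * γ))) with hFdef
  have hF : Differentiable ℂ F := by fun_prop
  have hPhi (t : ℝ) : PhiVal α β γ δ ε κ μ x (1 - 2 * t) = F t := by
    simp [PhiVal, hFdef]
  have hlim := tendsto_bernstein_of_entire hF (((1 - h) / 2 : ℝ) : ℂ)
  rw [← hPhi, show 1 - 2 * ((1 - h) / 2) = h by ring] at hlim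
  refine hlim.congr fun n => sum_congr rfl fun k _ => ?_
  have hk := hPhi (k / n)
  rw [← mul_div_assoc] at hk
  push_cast at hk
  rw [hk, supC]
  have hq : (1 : ℂ) - (((1 - h) / 2 : ℝ) : ℂ) = (((1 + h) / 2 : ℝ) : ℂ) := by
    push_cast
    ring
  rw [hq]
  push_cast
  ring
end

section
/- Let p₀, p₁, p₂ be arbitrary complex numbers and let h be a real number. Then lim_{n→∞} ∑_{k=0}^{n} C_k(n,h) · exp( p₂·(1 − 2k/n)² + p₁·(1 − 2k/n) + p₀ ) = exp( p₂·h² + p₁·h + p₀ ). (In particular this holds for every h > 1, which is the superoscillatory regime, since each frequency 1 − 2k/n lies in [−1,1].) -/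
open Complex Filter Finset

/-- The unnormalized `m`-th moment of the (complex) binomial weights with parameters `n`, `x`. -/
noncomputable def binomialMoment (x : ℂ) (n m : ℕ) : ℂ :=
  ∑ k ∈ Finset.range (n + 1), (n.choose k : ℂ) * x ^ k * (1 - x) ^ (n - k) * (k : ℂ) ^ m

theorem binomialMoment_zero_right (x : ℂ) (n : ℕ) : binomialMoment x n 0 = 1 := by
  have h := add_pow x (1 - x) n
  rw [add_sub_cancel, one_pow] at h
  rw [h, binomialMoment]
  exact Finset.sum_congr rfl fun k _ => by ring

theorem binomialMoment_zero_left (x : ℂ) (m : ℕ) : binomialMoment x 0 m = 0 ^ m := by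
  simp [binomialMoment]

theorem binomialMoment_succ_succ (x : ℂ) (n m : ℕ) :
    binomialMoment x (n + 1) (m + 1) =
      (n + 1) * x * ∑ i ∈ Finset.range (m + 1), binomialMoment x n i * (m.choose i : ℂ) := by
  have hexp : ∑ i ∈ Finset.range (m + 1), binomialMoment x n i * (m.choose i : ℂ) =
      ∑ k ∈ Finset.range (n + 1),
        (n.choose k : ℂ) * x ^ k * (1 - x) ^ (n - k) * ((k : ℂ) + 1) ^ m := by
    simp only [binomialMoment, Finset.sum_mul]
    rw [Finset.sum_comm]
    refine Finset.sum_congr rfl fun k _ => ?_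
    rw [add_pow, Finset.mul_sum]
    exact Finset.sum_congr rfl fun i _ => by rw [one_pow]; ring
  rw [hexp, binomialMoment, Finset.sum_range_succ', Finset.mul_sum]
  simp only [Nat.cast_zero, zero_pow (Nat.succ_ne_zero m), mul_zero, add_zero]
  refine Finset.sum_congr rfl fun k _ => ?_
  have hc : ((n + 1 : ℂ)) * n.choose k = (n + 1).choose (k + 1) * (k + 1) := by
    exact_mod_cast Nat.add_one_mul_choose_eq n k
  rw [Nat.add_sub_add_right]
  push_cast
  linear_combination (-(x ^ (k + 1) * (1 - x) ^ (n - k) * ((k : ℂ) + 1) ^ m)) * hc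

theorem norm_binomialMoment_le {x : ℂ} {R : ℝ} (hR : 1 ≤ R) (hx : ‖x‖ ≤ R) (n m : ℕ) :
    ‖binomialMoment x n m‖ ≤ (n * R) ^ m := by
  induction n generalizing m with
  | zero => simp [binomialMoment_zero_left]
  | succ n ih =>
    cases m with
    | zero => simp [binomialMoment_zero_right]
    | succ m =>
      have hn : ‖(n + 1 : ℂ)‖ = n + 1 := by
        exact_mod_cast Complex.norm_natCast (n + 1)
      have hsum : ‖∑ i ∈ Finset.range (m + 1), binomialMoment x n i * (m.choose i : ℂ)‖ ≤
          (n * R + 1) ^ m := by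
        rw [add_pow]
        refine (norm_sum_le _ _).trans (Finset.sum_le_sum fun i _ => ?_)
        rw [norm_mul, Complex.norm_natCast, one_pow, mul_one]
        gcongr
        exact ih i
      rw [binomialMoment_succ_succ, norm_mul, norm_mul, hn, pow_succ']
      push_cast
      calc (n + 1) * ‖x‖ * _ ≤ (n + 1) * R * (n * R + 1) ^ m := by gcongr
        _ ≤ (n + 1) * R * ((n + 1) * R) ^ m := by
          gcongr
          linarith

theorem tendsto_binomialMoment_div_pow (x : ℂ) (m : ℕ) :
    Tendsto (fun n : ℕ => binomialMoment x n m / (n : ℂ) ^ m) atTop (nhds (x ^ m)) := by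
  induction m using Nat.strong_induction_on with
  | _ m ih =>
    cases m with
    | zero => simp [binomialMoment_zero_right]
    | succ m =>
      rw [← tendsto_add_atTop_iff_nat 1]
      have hinv : Tendsto (fun n : ℕ => 1 / ((n : ℂ) + 1)) atTop (nhds 0) :=
        tendsto_one_div_add_atTop_nhds_zero_nat
      have hone : Tendsto (fun n : ℕ => 1 - 1 / ((n : ℂ) + 1)) atTop (nhds 1) := by
        simpa using hinv.const_sub 1
      have hlim : Tendsto (fun n : ℕ => x * ∑ i ∈ Finset.range (m + 1),
          binomialMoment x n i / (n : ℂ) ^ i * (1 - 1 / ((n : ℂ) + 1)) ^ i *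
            (1 / ((n : ℂ) + 1)) ^ (m - i) * (m.choose i : ℂ)) atTop
          (nhds (x * ∑ i ∈ Finset.range (m + 1),
            x ^ i * 1 ^ i * 0 ^ (m - i) * (m.choose i : ℂ))) :=
        (tendsto_finsetSum _ fun i hi => (((ih i (Finset.mem_range.1 hi)).mul
          (hone.pow i)).mul (hinv.pow (m - i))).mul_const _).const_mul x
      have hval : x * ∑ i ∈ Finset.range (m + 1),
          x ^ i * 1 ^ i * 0 ^ (m - i) * (m.choose i : ℂ) = x ^ (m + 1) := by
        simp only [one_pow, mul_one]
        rw [← add_pow, add_zero, pow_succ']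
      rw [hval] at hlim
      refine hlim.congr' ?_
      filter_upwards [eventually_ge_atTop 1] with n hn
      have hn0 : (n : ℂ) ≠ 0 := by exact_mod_cast (by omega : n ≠ 0)
      have hn1 : (n : ℂ) + 1 ≠ 0 := by exact_mod_cast Nat.succ_ne_zero n
      rw [binomialMoment_succ_succ, Nat.cast_add_one, pow_succ' (_ : ℂ) m, mul_assoc,
        mul_div_mul_left _ _ hn1, mul_div_assoc, Finset.sum_div]
      congr 1
      refine Finset.sum_congr rfl fun i hi => ?_
      have him : m = i + (m - i) := by
        have := Finset.mem_range.1 hi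
        omega
      have hsub : 1 - 1 / ((n : ℂ) + 1) = n / (n + 1) := by
        field_simp
        ring
      have hpow : ((n : ℂ) + 1) ^ m = (n + 1) ^ i * (n + 1) ^ (m - i) := by
        rw [← pow_add, ← him]
      rw [hsub, hpow, div_pow, div_pow, one_pow]
      field_simp

/-- The Bernstein sums of an entire function converge to it at every complex point. -/
theorem Differentiable.tendsto_bernstein_sum {f : ℂ → ℂ} (hf : Differentiable ℂ f) (x : ℂ) :
    Tendsto (fun n : ℕ => ∑ k ∈ Finset.range (n + 1),
      (n.choose k : ℂ) * x ^ k * (1 - x) ^ (n - k) * f (k / n)) atTop (nhds (f x)) := by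
  obtain ⟨a, ha⟩ : ∃ a : ℕ → ℂ, ∀ z, HasSum (fun m => a m * z ^ m) (f z) := by
    refine ⟨fun m => (m.factorial : ℂ)⁻¹ * iteratedDeriv m f 0, fun z => ?_⟩
    refine (Complex.hasSum_taylorSeries_of_entire hf 0 z).congr_fun ?_
    intro m
    simp only [sub_zero, smul_eq_mul]
    ring
  set R : ℝ := max 1 ‖x‖
  have hR : 1 ≤ R := le_max_left _ _
  have hbound : Summable fun m => ‖a m‖ * R ^ m := by
    refine (ha (R : ℂ)).summable.norm.congr fun m => ?_
    rw [norm_mul, norm_pow, Complex.norm_real, Real.norm_of_nonneg (by linarith)]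
  have hterm : ∀ n : ℕ, ∑ k ∈ Finset.range (n + 1),
      (n.choose k : ℂ) * x ^ k * (1 - x) ^ (n - k) * f (k / n) =
        ∑' m, a m * (binomialMoment x n m / (n : ℂ) ^ m) := by
    intro n
    refine (HasSum.tsum_eq ?_).symm
    refine (hasSum_sum fun (k : ℕ) _ => (ha ((k : ℂ) / n)).mul_left
      ((n.choose k : ℂ) * x ^ k * (1 - x) ^ (n - k))).congr_fun fun m => ?_
    rw [binomialMoment, Finset.sum_div, Finset.mul_sum]
    exact Finset.sum_congr rfl fun k _ => by rw [div_pow]; ring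
  simp only [hterm]
  rw [← (ha x).tsum_eq]
  refine tendsto_tsum_of_dominated_convergence hbound
    (fun m => (tendsto_binomialMoment_div_pow x m).const_mul (a m))
    (Eventually.of_forall fun n m => ?_)
  rw [norm_mul, norm_div, norm_pow, Complex.norm_natCast]
  gcongr
  refine div_le_of_le_mul₀ (by positivity) (by positivity) ?_
  rw [← mul_pow, mul_comm R]
  exact norm_binomialMoment_le hR (le_max_right _ _) n m

/-- For arbitrary complex `p₀, p₁, p₂` and real `h`,
`∑_{k=0}^{n} C_k(n,h) exp(p₂(1−2k/n)² + p₁(1−2k/n) + p₀) → exp(p₂h² + p₁h + p₀)`. -/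
theorem superoscillation_quadratic_exponential (p₀ p₁ p₂ : ℂ) (h : ℝ) :
    Filter.Tendsto
      (fun n : ℕ => ∑ k ∈ Finset.range (n + 1),
        (supC n k h : ℂ) *
          Complex.exp (p₂ * ((1 - 2 * k / n : ℝ) : ℂ) ^ 2
            + p₁ * ((1 - 2 * k / n : ℝ) : ℂ) + p₀))
      Filter.atTop
      (nhds (Complex.exp (p₂ * (h : ℂ) ^ 2 + p₁ * (h : ℂ) + p₀))) := by
  have hf : Differentiable ℂ fun z : ℂ =>
      Complex.exp (p₂ * (1 - 2 * z) ^ 2 + p₁ * (1 - 2 * z) + p₀) := by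
    fun_prop
  have key := hf.tendsto_bernstein_sum ((1 - h) / 2 : ℂ)
  rw [show (1 : ℂ) - 2 * ((1 - h) / 2) = h by ring] at key
  refine key.congr fun n => Finset.sum_congr rfl fun k _ => ?_
  rw [supC, show (1 : ℂ) - (1 - h) / 2 = (1 + h) / 2 by ring]
  push_cast
  rw [mul_div_assoc (2 : ℂ)]
  ring
end

section
/- Let h > 1 be a real number, let p ≥ 2 be an even integer, and let L > 0. Then the sequence Y_n(x) := ∑_{k=0}^{n} C_k(n,h) · exp( i·x·(−i·(1 − 2k/n))^p ) converges, uniformly for x ∈ [−L, L], to exp( i·x·(−i·h)^p ); that is, sup_{x∈[−L,L]} | Y_n(x) − exp(i·x·(−i·h)^p) | → 0 as n → ∞. -/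
open Complex Filter Finset

/-- The `m`-th moment `∑ C_k(n,h) (n - 2k)^m` of the signed binomial weights. -/
noncomputable def supMoment (h : ℝ) (n m : ℕ) : ℝ :=
  ∑ k ∈ Finset.range (n + 1), supC n k h * ((n : ℝ) - 2 * k) ^ m

theorem sum_supC_succ (h : ℝ) (n : ℕ) (g : ℝ → ℝ) :
    ∑ k ∈ Finset.range (n + 2), supC (n + 1) k h * g (((n + 1 : ℕ) : ℝ) - 2 * k) =
      ∑ k ∈ Finset.range (n + 1), supC n k h *
        ((1 + h) / 2 * g ((n : ℝ) - 2 * k + 1) + (1 - h) / 2 * g ((n : ℝ) - 2 * k - 1)) := by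
  have key := Finset.sum_choose_succ_mul
    (fun k l => ((1 + h) / 2) ^ l * ((1 - h) / 2) ^ k * g ((l : ℝ) - k)) n
  have hl : ∑ k ∈ Finset.range (n + 2), supC (n + 1) k h * g (((n + 1 : ℕ) : ℝ) - 2 * k) =
      ∑ k ∈ Finset.range (n + 2), ((n + 1).choose k : ℝ) *
        (((1 + h) / 2) ^ (n + 1 - k) * ((1 - h) / 2) ^ k * g (((n + 1 - k : ℕ) : ℝ) - k)) := by
    refine Finset.sum_congr rfl fun k hk => ?_
    have hk' : k ≤ n + 1 := Nat.lt_succ_iff.mp (Finset.mem_range.mp hk)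
    rw [supC, Nat.cast_sub hk', two_mul, ← sub_sub]
    ring
  rw [hl, key, ← Finset.sum_add_distrib]
  refine Finset.sum_congr rfl fun k hk => ?_
  have hk' : k ≤ n := Nat.lt_succ_iff.mp (Finset.mem_range.mp hk)
  have e1 : ((n + 1 - k : ℕ) : ℝ) - k = (n : ℝ) - 2 * k + 1 := by
    rw [Nat.cast_sub (hk'.trans n.le_succ)]; push_cast; ring
  have e2 : ((n - k : ℕ) : ℝ) - (k + 1 : ℕ) = (n : ℝ) - 2 * k - 1 := by
    rw [Nat.cast_sub hk']; push_cast; ring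
  rw [e1, e2, supC, Nat.succ_sub hk', pow_succ, pow_succ]
  ring

theorem supMoment_zero_left (h : ℝ) (m : ℕ) : supMoment h 0 m = 0 ^ m := by
  simp [supMoment, supC]

theorem supMoment_succ (h : ℝ) (n m : ℕ) :
    supMoment h (n + 1) m = ∑ j ∈ Finset.range (m + 1),
      supMoment h n j * ((1 + h) / 2 + (1 - h) / 2 * (-1) ^ (m - j)) * m.choose j := by
  rw [supMoment, sum_supC_succ h n (fun y => y ^ m)]
  simp only [supMoment, Finset.sum_mul]
  rw [Finset.sum_comm]
  refine Finset.sum_congr rfl fun k _ => ?_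
  rw [sub_eq_add_neg _ (1 : ℝ), add_pow, add_pow, Finset.mul_sum, Finset.mul_sum,
    ← Finset.sum_add_distrib, Finset.mul_sum]
  refine Finset.sum_congr rfl fun j _ => ?_
  rw [one_pow]
  ring

theorem one_le_signMoment {h : ℝ} (hh : 1 ≤ h) (r : ℕ) :
    1 ≤ (1 + h) / 2 + (1 - h) / 2 * (-1) ^ r := by
  rcases neg_one_pow_eq_or ℝ r with e | e <;> rw [e] <;> linarith

theorem signMoment_le_pow {h : ℝ} (hh : 1 ≤ h) (r : ℕ) :
    (1 + h) / 2 + (1 - h) / 2 * (-1) ^ r ≤ h ^ r := by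
  rcases Nat.even_or_odd r with hr | hr
  · rw [hr.neg_one_pow]
    linarith [one_le_pow₀ hh (n := r)]
  · rw [hr.neg_one_pow]
    linarith [le_self_pow₀ hh hr.pos.ne']

theorem supMoment_nonneg {h : ℝ} (hh : 1 ≤ h) (n m : ℕ) : 0 ≤ supMoment h n m := by
  induction n generalizing m with
  | zero => rw [supMoment_zero_left]; positivity
  | succ n ih =>
    rw [supMoment_succ]
    exact Finset.sum_nonneg fun j _ => mul_nonneg
      (mul_nonneg (ih j) (zero_le_one.trans (one_le_signMoment hh _))) (Nat.cast_nonneg _)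

theorem supMoment_le {h : ℝ} (hh : 1 ≤ h) (n m : ℕ) : supMoment h n m ≤ (n * h) ^ m := by
  induction n generalizing m with
  | zero => simp [supMoment_zero_left]
  | succ n ih =>
    rw [supMoment_succ, Nat.cast_succ, add_one_mul, add_pow]
    refine Finset.sum_le_sum fun j _ => mul_le_mul_of_nonneg_right ?_ (Nat.cast_nonneg _)
    exact mul_le_mul (ih j) (signMoment_le_pow hh _)
      (zero_le_one.trans (one_le_signMoment hh _)) (by positivity)

theorem descFactorial_mul_pow_le_supMoment {h : ℝ} (hh : 1 ≤ h) (n m : ℕ) :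
    n.descFactorial m * h ^ m ≤ supMoment h n m := by
  induction n generalizing m with
  | zero => cases m <;> simp [supMoment_zero_left]
  | succ n ih =>
    have hterm (j : ℕ) : 0 ≤ supMoment h n j *
        ((1 + h) / 2 + (1 - h) / 2 * (-1) ^ (m - j)) * m.choose j :=
      mul_nonneg (mul_nonneg (supMoment_nonneg hh n j)
        (zero_le_one.trans (one_le_signMoment hh _))) (Nat.cast_nonneg _)
    rw [supMoment_succ]
    cases m with
    | zero =>
      have h0 : (1 + h) / 2 + (1 - h) / 2 = 1 := by ring
      simpa [h0] using ih 0
    | succ m =>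
      rw [Finset.sum_range_succ, Finset.sum_range_succ]
      have hrest := Finset.sum_nonneg fun j (_ : j ∈ Finset.range m) => hterm j
      have h1 := ih (m + 1)
      have h2 := ih m
      have hdesc : ((n + 1).descFactorial (m + 1) : ℝ) =
          n.descFactorial (m + 1) + (m + 1) * n.descFactorial m := by
        rcases le_or_gt m n with hmn | hmn
        · rw [Nat.succ_descFactorial_succ, Nat.descFactorial_succ]
          push_cast [Nat.cast_sub hmn]
          ring
        · rw [Nat.descFactorial_of_lt hmn, Nat.descFactorial_of_lt (hmn.trans m.lt_succ_self),
            Nat.descFactorial_of_lt (Nat.succ_lt_succ hmn)]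
          simp
      have h3 : (m + 1) * h * (n.descFactorial m * h ^ m) ≤ (m + 1) * h * supMoment h n m :=
        mul_le_mul_of_nonneg_left h2 (by positivity)
      rw [hdesc]
      simp only [Nat.sub_self, Nat.add_sub_cancel_left, pow_zero, pow_one, Nat.choose_self,
        Nat.choose_succ_self_right]
      push_cast
      rw [pow_succ] at h1 ⊢
      linarith

theorem sum_supC_mul_pow (h : ℝ) {n : ℕ} (hn : n ≠ 0) (m : ℕ) :
    ∑ k ∈ Finset.range (n + 1), supC n k h * (1 - 2 * k / n : ℝ) ^ m =
      supMoment h n m / (n : ℝ) ^ m := by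
  have hn' : (n : ℝ) ≠ 0 := Nat.cast_ne_zero.mpr hn
  rw [supMoment, Finset.sum_div]
  refine Finset.sum_congr rfl fun k _ => ?_
  rw [mul_div_assoc (supC n k h), ← div_pow, sub_div, div_self hn']

theorem supMoment_div_le {h : ℝ} (hh : 1 ≤ h) (n m : ℕ) :
    supMoment h n m / (n : ℝ) ^ m ≤ h ^ m := by
  refine div_le_of_le_mul₀ (by positivity) (by positivity) ?_
  rw [← mul_pow, mul_comm h]
  exact supMoment_le hh n m

theorem tendsto_supMoment_div {h : ℝ} (hh : 1 ≤ h) (m : ℕ) :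
    Tendsto (fun n : ℕ => supMoment h n m / (n : ℝ) ^ m) atTop (nhds (h ^ m)) := by
  have hdesc : Tendsto (fun n : ℕ => (n.descFactorial m : ℝ) / (n : ℝ) ^ m) atTop (nhds 1) :=
    (Asymptotics.isEquivalent_iff_tendsto_one ((eventually_ne_atTop 0).mono fun n hn => by
      positivity)).mp (isEquivalent_descFactorial m)
  refine tendsto_of_tendsto_of_tendsto_of_le_of_le (by simpa using hdesc.mul_const (h ^ m))
    tendsto_const_nhds (fun n => ?_) (fun n => supMoment_div_le hh n m)
  rw [div_mul_eq_mul_div]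
  exact div_le_div_of_nonneg_right (descFactorial_mul_pow_le_supMoment hh n m) (by positivity)

theorem hasSum_exp_mul_pow (z s : ℂ) (p : ℕ) :
    HasSum (fun j : ℕ => z ^ j / (j.factorial : ℂ) * s ^ (p * j)) (Complex.exp (z * s ^ p)) := by
  have := NormedSpace.expSeries_div_hasSum_exp (z * s ^ p)
  rw [← Complex.exp_eq_exp_ℂ] at this
  refine this.congr_fun ?_
  intro j
  rw [mul_pow, ← pow_mul]
  ring

theorem summable_pow_div_factorial_mul_pow (L h : ℝ) (p : ℕ) :
    Summable fun j : ℕ => L ^ j / j.factorial * h ^ (p * j) := by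
  refine (Real.summable_pow_div_factorial (L * h ^ p)).congr fun j => ?_
  rw [mul_pow, ← pow_mul]
  ring

theorem norm_moment_gap_le {h : ℝ} (hh : 1 ≤ h) (p : ℕ) {L : ℝ} (hL : 0 ≤ L) (n j : ℕ) :
    ‖L ^ j / j.factorial * (h ^ (p * j) - supMoment h n (p * j) / (n : ℝ) ^ (p * j))‖ ≤
      L ^ j / j.factorial * h ^ (p * j) := by
  rw [Real.norm_of_nonneg (mul_nonneg (by positivity)
    (sub_nonneg.mpr (supMoment_div_le hh n (p * j))))]
  have := supMoment_nonneg hh n (p * j)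
  exact mul_le_mul_of_nonneg_left (sub_le_self _ (by positivity)) (by positivity)

theorem summable_moment_gap {h : ℝ} (hh : 1 ≤ h) (p : ℕ) {L : ℝ} (hL : 0 ≤ L) (n : ℕ) :
    Summable fun j : ℕ => L ^ j / j.factorial *
      (h ^ (p * j) - supMoment h n (p * j) / (n : ℝ) ^ (p * j)) :=
  (summable_pow_div_factorial_mul_pow L h p).of_norm_bounded (norm_moment_gap_le hh p hL n)

theorem tendsto_tsum_moment_gap {h : ℝ} (hh : 1 ≤ h) (p : ℕ) {L : ℝ} (hL : 0 ≤ L) :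
    Tendsto (fun n : ℕ => ∑' j : ℕ, L ^ j / j.factorial *
      (h ^ (p * j) - supMoment h n (p * j) / (n : ℝ) ^ (p * j))) atTop (nhds 0) := by
  have := tendsto_tsum_of_dominated_convergence (𝓕 := atTop)
    (summable_pow_div_factorial_mul_pow L h p)
    (fun j => ((tendsto_supMoment_div hh (p * j)).const_sub (h ^ (p * j))).const_mul
      (L ^ j / j.factorial))
    (Eventually.of_forall fun n j => norm_moment_gap_le hh p hL n j)
  simpa using this

theorem norm_sum_supC_mul_exp_sub_le {h : ℝ} (hh : 1 ≤ h) (p : ℕ) {L : ℝ} {n : ℕ} (hn : n ≠ 0)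
    {z : ℂ} (hz : ‖z‖ ≤ L) :
    ‖∑ k ∈ Finset.range (n + 1), (supC n k h : ℂ) *
        Complex.exp (z * ((1 - 2 * k / n : ℝ) : ℂ) ^ p) - Complex.exp (z * (h : ℂ) ^ p)‖ ≤
      ∑' j : ℕ, L ^ j / j.factorial *
        (h ^ (p * j) - supMoment h n (p * j) / (n : ℝ) ^ (p * j)) := by
  have hL : 0 ≤ L := (norm_nonneg z).trans hz
  have hsum := (hasSum_sum fun k (_ : k ∈ Finset.range (n + 1)) =>
    (hasSum_exp_mul_pow z ((1 - 2 * k / n : ℝ) : ℂ) p).mul_left (supC n k h : ℂ)).sub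
    (hasSum_exp_mul_pow z (h : ℂ) p)
  rw [← hsum.tsum_eq]
  refine tsum_of_norm_bounded (summable_moment_gap hh p hL n).hasSum fun j => ?_
  have e : ∑ k ∈ Finset.range (n + 1), (supC n k h : ℂ) *
      (z ^ j / (j.factorial : ℂ) * ((1 - 2 * k / n : ℝ) : ℂ) ^ (p * j)) -
      z ^ j / (j.factorial : ℂ) * (h : ℂ) ^ (p * j) =
      z ^ j / (j.factorial : ℂ) *
        ((supMoment h n (p * j) / (n : ℝ) ^ (p * j) - h ^ (p * j) : ℝ) : ℂ) := by
    rw [← sum_supC_mul_pow h hn]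
    push_cast
    rw [mul_sub, Finset.mul_sum]
    congr 1
    exact Finset.sum_congr rfl fun k _ => by ring
  rw [e, norm_mul, norm_div, norm_pow, Complex.norm_natCast, Complex.norm_real,
    Real.norm_of_nonpos (sub_nonpos.mpr (supMoment_div_le hh n _)), neg_sub]
  have := sub_nonneg.mpr (supMoment_div_le hh n (p * j))
  gcongr

/-- For `h > 1`, even `p ≥ 2`, and `L > 0`, the sequence
`Y_n(x) = ∑_{k=0}^{n} C_k(n,h) exp(i x (−i(1−2k/n))^p)` converges uniformly on `[−L,L]`
to `exp(i x (−i h)^p)`. -/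
theorem superoscillation_even_power_uniform (h : ℝ) (hh : 1 < h)
    (p : ℕ) (hp : Even p) (hp2 : 2 ≤ p) (L : ℝ) (hL : 0 < L) :
    TendstoUniformlyOn
      (fun (n : ℕ) (x : ℝ) => ∑ k ∈ Finset.range (n + 1),
        (supC n k h : ℂ) *
          Complex.exp (Complex.I * (x : ℂ) *
            (-Complex.I * ((1 - 2 * k / n : ℝ) : ℂ)) ^ p))
      (fun x : ℝ => Complex.exp (Complex.I * (x : ℂ) * (-Complex.I * (h : ℂ)) ^ p))
      Filter.atTop (Set.Icc (-L) L) := by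
  rw [Metric.tendstoUniformlyOn_iff]
  intro ε hε
  filter_upwards [(tendsto_tsum_moment_gap hh.le p hL.le).eventually_lt_const hε,
    eventually_ne_atTop 0] with n hlt hn x hx
  have hz : ‖Complex.I * (x : ℂ) * (-Complex.I) ^ p‖ ≤ L := by
    simpa using abs_le.mpr hx
  rw [dist_comm, dist_eq_norm]
  refine lt_of_le_of_lt ?_ hlt
  simpa only [mul_pow, mul_assoc] using norm_sum_supC_mul_exp_sub_le hh.le p hn hz
end

section
/- Let r ≥ 0 be an integer (so p := 2r + 1 is odd), let A and B be arbitrary complex numbers, and let h > 1 be real. Then lim_{n→∞} ∑_{k=0}^{n} C_k(n,h) · exp( A·(−i·(1 − 2k/n))^{2r+1} + B·(−i·(1 − 2k/n))^{2(2r+1)} ) = exp( A·(−i·h)^{2r+1} + B·(−i·h)^{2(2r+1)} ). (This gives the persistence in time of superoscillations for the Schrödinger equation with quadratic Hamiltonian and superoscillating initial data Z_n(x) = ∑_k C_k(n,h) e^{x(−i(1−2k/n))^p} of odd power type.) -/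
open Complex Filter Finset

/-- Powers expand in falling factorials with Stirling numbers of the second kind. -/
theorem pow_eq_sum_stirlingSecond_mul_descFactorial (x m : ℕ) :
    x ^ m = ∑ j ∈ range (m + 1), Nat.stirlingSecond m j * x.descFactorial j := by
  induction m with
  | zero => simp
  | succ m ih =>
    have mul_desc (j : ℕ) :
        x * x.descFactorial j = x.descFactorial (j + 1) + j * x.descFactorial j := by
      rw [Nat.descFactorial_succ, ← add_mul]
      rcases lt_or_ge x j with hx | hx
      · simp [Nat.descFactorial_of_lt hx]
      · rw [Nat.sub_add_cancel hx]
    have shift : ∑ j ∈ range (m + 1),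
          (j + 1) * Nat.stirlingSecond m (j + 1) * x.descFactorial (j + 1)
        = ∑ j ∈ range (m + 1), j * Nat.stirlingSecond m j * x.descFactorial j := by
      have hl := sum_range_succ' (fun j => j * Nat.stirlingSecond m j * x.descFactorial j) (m + 1)
      have hr := sum_range_succ (fun j => j * Nat.stirlingSecond m j * x.descFactorial j) (m + 1)
      rw [Nat.stirlingSecond_eq_zero_of_lt (Nat.lt_succ_self m)] at hr
      simp only [zero_mul, mul_zero, add_zero] at hl hr
      rw [← hl, hr]
    rw [sum_range_succ', Nat.stirlingSecond_succ_zero, zero_mul, add_zero, pow_succ', ih, mul_sum]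
    simp only [Nat.stirlingSecond_succ_succ, add_mul, sum_add_distrib] at shift ⊢
    rw [shift, ← sum_add_distrib]
    refine sum_congr rfl fun j _ => ?_
    rw [mul_left_comm, mul_desc]
    ring

/-- The factorial moments of the (complex-weighted) binomial distribution. -/
theorem sum_binomial_mul_descFactorial {R : Type*} [CommRing R] (q : R) (n j : ℕ) :
    ∑ k ∈ range (n + 1), (n.choose k : R) * (1 - q) ^ (n - k) * q ^ k * (k.descFactorial j : R)
      = (n.descFactorial j : R) * q ^ j := by
  induction j generalizing n with
  | zero =>
    have h := add_pow q (1 - q) n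
    rw [add_sub_cancel, one_pow] at h
    simp only [Nat.descFactorial_zero, Nat.cast_one, mul_one, pow_zero]
    exact (sum_congr rfl fun k _ => by ring).trans h.symm
  | succ j ih =>
    cases n with
    | zero => simp
    | succ n =>
      rw [sum_range_succ', Nat.zero_descFactorial_succ, Nat.cast_zero, mul_zero, add_zero,
        Nat.succ_descFactorial_succ, Nat.cast_mul, pow_succ', mul_mul_mul_comm, ← ih n, mul_sum]
      refine sum_congr rfl fun k _ => ?_
      have h : ((n + 1 : ℕ) : R) * (n.choose k : R)
          = ((n + 1).choose (k + 1) : R) * ((k + 1 : ℕ) : R) := by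
        rw [← Nat.cast_mul, ← Nat.cast_mul, Nat.add_one_mul_choose_eq n k]
      rw [Nat.succ_descFactorial_succ, Nat.cast_mul, Nat.add_sub_add_right, pow_succ]
      linear_combination (-(1 - q) ^ (n - k) * q ^ k * q * (k.descFactorial j : R)) * h

/-- The Bernstein polynomial of the monomial `t ^ m`, evaluated at the complex point `q`. -/
theorem sum_binomial_mul_pow (q : ℂ) (n m : ℕ) :
    ∑ k ∈ range (n + 1),
        (n.choose k : ℂ) * (1 - q) ^ (n - k) * q ^ k * ((k : ℂ) / (n : ℂ)) ^ m
      = ∑ j ∈ range (m + 1),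
        (Nat.stirlingSecond m j : ℂ) * ((n.descFactorial j : ℂ) / (n : ℂ) ^ m) * q ^ j := by
  have hpow (k : ℕ) : (k : ℂ) ^ m
      = ∑ j ∈ range (m + 1), (Nat.stirlingSecond m j : ℂ) * (k.descFactorial j : ℂ) := by
    exact_mod_cast pow_eq_sum_stirlingSecond_mul_descFactorial k m
  simp only [div_pow, hpow, sum_div, mul_sum]
  rw [sum_comm]
  refine sum_congr rfl fun j _ => ?_
  rw [← hpow n, mul_assoc, div_mul_eq_mul_div, ← sum_binomial_mul_descFactorial q n j, sum_div,
    mul_sum]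
  exact sum_congr rfl fun k _ => by ring

theorem norm_sum_binomial_mul_pow_le (q : ℂ) {n : ℕ} (hn : n ≠ 0) (m : ℕ) :
    ‖∑ k ∈ range (n + 1),
        (n.choose k : ℂ) * (1 - q) ^ (n - k) * q ^ k * ((k : ℂ) / (n : ℂ)) ^ m‖
      ≤ (max 1 ‖q‖) ^ m := by
  have hn' : (n : ℝ) ^ m ≠ 0 := pow_ne_zero _ (Nat.cast_ne_zero.mpr hn)
  have hpow : (n : ℝ) ^ m
      = ∑ j ∈ range (m + 1), (Nat.stirlingSecond m j : ℝ) * (n.descFactorial j : ℝ) := by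
    exact_mod_cast pow_eq_sum_stirlingSecond_mul_descFactorial n m
  rw [sum_binomial_mul_pow]
  calc _ ≤ ∑ j ∈ range (m + 1),
        (Nat.stirlingSecond m j : ℝ) * ((n.descFactorial j : ℝ) / (n : ℝ) ^ m)
          * (max 1 ‖q‖) ^ m := by
        refine norm_sum_le_of_le _ fun j hj => ?_
        simp only [norm_mul, norm_div, norm_pow, RCLike.norm_natCast]
        gcongr
        calc ‖q‖ ^ j ≤ (max 1 ‖q‖) ^ j := by gcongr; exact le_max_right _ _
          _ ≤ (max 1 ‖q‖) ^ m :=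
            pow_le_pow_right₀ (le_max_left _ _) (Nat.lt_succ_iff.mp (mem_range.mp hj))
    _ = (max 1 ‖q‖) ^ m := by
        rw [← sum_mul]
        simp only [← mul_div_assoc]
        rw [← sum_div, ← hpow, div_self hn', one_mul]

theorem tendsto_descFactorial_div_pow_self (j : ℕ) :
    Tendsto (fun n : ℕ => (n.descFactorial j : ℝ) / (n : ℝ) ^ j) atTop (nhds 1) := by
  refine (Asymptotics.isEquivalent_iff_tendsto_one ?_).mp (isEquivalent_descFactorial j)
  filter_upwards [eventually_ne_atTop 0] with n hn
  exact pow_ne_zero _ (Nat.cast_ne_zero.mpr hn)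

theorem tendsto_descFactorial_div_pow_of_lt {j m : ℕ} (hj : j < m) :
    Tendsto (fun n : ℕ => (n.descFactorial j : ℝ) / (n : ℝ) ^ m) atTop (nhds 0) := by
  have hinv : Tendsto (fun n : ℕ => ((n : ℝ) ^ (m - j))⁻¹) atTop (nhds 0) :=
    tendsto_inv_atTop_zero.comp
      ((tendsto_pow_atTop (Nat.sub_ne_zero_of_lt hj)).comp tendsto_natCast_atTop_atTop)
  have h := (tendsto_descFactorial_div_pow_self j).mul hinv
  rw [mul_zero] at h
  refine h.congr fun n => ?_
  rw [← div_eq_mul_inv, div_div, ← pow_add, Nat.add_sub_cancel' hj.le]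

theorem tendsto_sum_binomial_mul_pow (q : ℂ) (m : ℕ) :
    Tendsto (fun n : ℕ => ∑ k ∈ range (n + 1),
        (n.choose k : ℂ) * (1 - q) ^ (n - k) * q ^ k * ((k : ℂ) / (n : ℂ)) ^ m)
      atTop (nhds (q ^ m)) := by
  simp only [sum_binomial_mul_pow]
  have hterm : ∀ j ∈ range m, Tendsto (fun n : ℕ =>
      (Nat.stirlingSecond m j : ℂ) * ((n.descFactorial j : ℂ) / (n : ℂ) ^ m) * q ^ j)
      atTop (nhds 0) := fun j hj => by
    have h := (continuous_ofReal.tendsto _).comp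
      (tendsto_descFactorial_div_pow_of_lt (mem_range.mp hj))
    simpa using (h.const_mul (Nat.stirlingSecond m j : ℂ)).mul_const (q ^ j)
  have htop := ((continuous_ofReal.tendsto _).comp
    (tendsto_descFactorial_div_pow_self m)).mul_const (q ^ m)
  simpa [sum_range_succ, Nat.stirlingSecond_self] using (tendsto_finsetSum _ hterm).add htop

/-- Bernstein polynomials of an entire function converge to it at every complex point. -/
theorem Differentiable.tendsto_sum_binomial_mul {F : ℂ → ℂ} (hF : Differentiable ℂ F) (q : ℂ) :
    Tendsto (fun n : ℕ => ∑ k ∈ range (n + 1),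
        (n.choose k : ℂ) * (1 - q) ^ (n - k) * q ^ k * F ((k : ℂ) / (n : ℂ)))
      atTop (nhds (F q)) := by
  set a : ℕ → ℂ := fun m => (m.factorial : ℂ)⁻¹ * iteratedDeriv m F 0 with ha
  have hsum (z : ℂ) : HasSum (fun m => a m * z ^ m) (F z) := by
    refine (hasSum_taylorSeries_of_entire hF 0 z).congr_fun fun m => ?_
    simp only [ha, sub_zero, smul_eq_mul]
    ring
  have hbound : Summable fun m => ‖a m‖ * (max 1 ‖q‖) ^ m := by
    have h := (hsum ((max 1 ‖q‖ : ℝ) : ℂ)).summable.norm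
    simpa [abs_of_nonneg (zero_le_one.trans (le_max_left 1 ‖q‖))] using h
  have hswap (n : ℕ) : ∑ k ∈ range (n + 1),
        (n.choose k : ℂ) * (1 - q) ^ (n - k) * q ^ k * F ((k : ℂ) / (n : ℂ))
      = ∑' m, a m * ∑ k ∈ range (n + 1),
        (n.choose k : ℂ) * (1 - q) ^ (n - k) * q ^ k * ((k : ℂ) / (n : ℂ)) ^ m := by
    refine ((hasSum_sum fun (k : ℕ) _ => (hsum ((k : ℂ) / (n : ℂ))).mul_left
      ((n.choose k : ℂ) * (1 - q) ^ (n - k) * q ^ k)).tsum_eq.symm).trans (tsum_congr fun m => ?_)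
    rw [mul_sum]
    exact sum_congr rfl fun k _ => by ring
  simp only [hswap]
  rw [← (hsum q).tsum_eq]
  refine tendsto_tsum_of_dominated_convergence hbound
    (fun m => (tendsto_sum_binomial_mul_pow q m).const_mul (a m)) ?_
  filter_upwards [eventually_ne_atTop 0] with n hn m
  rw [norm_mul]
  exact mul_le_mul_of_nonneg_left (norm_sum_binomial_mul_pow_le q hn m) (norm_nonneg _)

/-- For `r ≥ 0` (odd power `p = 2r+1`), arbitrary complex `A, B`, and
real `h > 1`,
`∑_{k=0}^{n} C_k(n,h) exp(A(−i(1−2k/n))^{2r+1} + B(−i(1−2k/n))^{2(2r+1)}) →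
exp(A(−ih)^{2r+1} + B(−ih)^{2(2r+1)})`. -/
theorem superoscillation_odd_power_persistence
    (r : ℕ) (A B : ℂ) (h : ℝ) (hh : 1 < h) :
    Filter.Tendsto
      (fun n : ℕ => ∑ k ∈ Finset.range (n + 1),
        (supC n k h : ℂ) *
          Complex.exp (A * (-Complex.I * ((1 - 2 * k / n : ℝ) : ℂ)) ^ (2 * r + 1)
            + B * (-Complex.I * ((1 - 2 * k / n : ℝ) : ℂ)) ^ (2 * (2 * r + 1))))
      Filter.atTop
      (nhds (Complex.exp (A * (-Complex.I * (h : ℂ)) ^ (2 * r + 1)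
        + B * (-Complex.I * (h : ℂ)) ^ (2 * (2 * r + 1))))) := by
  set F : ℂ → ℂ := fun t => Complex.exp (A * (-Complex.I * (1 - 2 * t)) ^ (2 * r + 1)
    + B * (-Complex.I * (1 - 2 * t)) ^ (2 * (2 * r + 1))) with hF
  have hdiff : Differentiable ℂ F := by fun_prop
  have hlim := hdiff.tendsto_sum_binomial_mul ((1 - h) / 2 : ℂ)
  have hq : (1 : ℂ) - 2 * ((1 - h) / 2) = h := by ring
  have hp : (1 : ℂ) - (1 - h) / 2 = (1 + h) / 2 := by ring
  simp only [hF, hq, hp] at hlim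
  refine hlim.congr fun n => sum_congr rfl fun k _ => ?_
  simp only [supC]
  push_cast
  rw [mul_div_assoc]
end

section
/- Let λ and ω be real numbers and let C₁, C₂ be real constants. Then the function μ(t) := C₁·e^{−λt}·(sin(ωt) − cos(ωt)) + C₂·e^{λt}·(sin(ωt) + cos(ωt)) satisfies, for every real t, the (cleared-denominator) Ince-type equation (ω + λ·cos(2ωt))·μ''(t) + 2λω·sin(2ωt)·μ'(t) + ( ω³ − 3ωλ² − (ω²λ + λ³)·cos(2ωt) )·μ(t) = 0. In particular, wherever ω + λ·cos(2ωt) ≠ 0, μ solves μ'' + [2λω sin(2ωt)/(ω + λcos(2ωt))]·μ' + [(ω³ − 3ωλ² − (ω²λ + λ³)cos(2ωt))/(ω + λcos(2ωt))]·μ = 0, which is the characteristic equation of the degenerate parametric oscillator. -/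
open Real

/-- The general solution of the Ince-type characteristic equation of the degenerate
parametric oscillator: `μ(t) = C₁e^{−λt}(sin ωt − cos ωt) + C₂e^{λt}(sin ωt + cos ωt)`. -/
noncomputable def inceSol (lam ω C₁ C₂ : ℝ) (t : ℝ) : ℝ :=
  C₁ * Real.exp (-lam * t) * (Real.sin (ω * t) - Real.cos (ω * t)) +
    C₂ * Real.exp (lam * t) * (Real.sin (ω * t) + Real.cos (ω * t))

theorem hasDerivAt_exp_mul_sin_add_cos (a ω α β t : ℝ) :
    HasDerivAt (fun t => Real.exp (a * t) * (α * Real.sin (ω * t) + β * Real.cos (ω * t)))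
      (Real.exp (a * t) * ((a * α - ω * β) * Real.sin (ω * t) +
        (a * β + ω * α) * Real.cos (ω * t))) t := by
  have hlin (k : ℝ) : HasDerivAt (fun t => k * t) k t := by
    simpa using (hasDerivAt_id t).const_mul k
  refine ((hlin a).exp.mul
    (((hlin ω).sin.const_mul α).add ((hlin ω).cos.const_mul β))).congr_deriv ?_
  simp only [Pi.add_apply]
  ring

theorem inceSol_eq (lam ω C₁ C₂ : ℝ) :
    inceSol lam ω C₁ C₂ = fun t =>
      Real.exp (-lam * t) * (C₁ * Real.sin (ω * t) + -C₁ * Real.cos (ω * t)) +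
        Real.exp (lam * t) * (C₂ * Real.sin (ω * t) + C₂ * Real.cos (ω * t)) := by
  funext t
  rw [inceSol]
  ring

theorem deriv_exp_mul_sin_add_cos_add (a b ω α β γ δ : ℝ) :
    deriv (fun t => Real.exp (a * t) * (α * Real.sin (ω * t) + β * Real.cos (ω * t)) +
        Real.exp (b * t) * (γ * Real.sin (ω * t) + δ * Real.cos (ω * t))) =
      fun t => Real.exp (a * t) * ((a * α - ω * β) * Real.sin (ω * t) +
          (a * β + ω * α) * Real.cos (ω * t)) +
        Real.exp (b * t) * ((b * γ - ω * δ) * Real.sin (ω * t) +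
          (b * δ + ω * γ) * Real.cos (ω * t)) :=
  funext fun t => ((hasDerivAt_exp_mul_sin_add_cos a ω α β t).add
    (hasDerivAt_exp_mul_sin_add_cos b ω γ δ t)).deriv

theorem inceSol_cleared (lam ω C₁ C₂ t : ℝ) :
    (ω + lam * Real.cos (2 * ω * t)) * deriv (deriv (inceSol lam ω C₁ C₂)) t
      + 2 * lam * ω * Real.sin (2 * ω * t) * deriv (inceSol lam ω C₁ C₂) t
      + (ω ^ 3 - 3 * ω * lam ^ 2 - (ω ^ 2 * lam + lam ^ 3) * Real.cos (2 * ω * t)) *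
          inceSol lam ω C₁ C₂ t = 0 := by
  simp only [inceSol_eq, deriv_exp_mul_sin_add_cos_add]
  rw [mul_assoc 2 ω t, Real.cos_two_mul', Real.sin_two_mul]
  linear_combination
    (2 * ω * lam ^ 2 * (Real.exp (-lam * t) * C₁ * (Real.cos (ω * t) - Real.sin (ω * t))
        - Real.exp (lam * t) * C₂ * (Real.cos (ω * t) + Real.sin (ω * t)))
      + 2 * lam * ω ^ 2 * (Real.exp (lam * t) * C₂ * (Real.cos (ω * t) - Real.sin (ω * t))
        - Real.exp (-lam * t) * C₁ * (Real.cos (ω * t) + Real.sin (ω * t))))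
      * (-Real.sin_sq_add_cos_sq (ω * t))

/-- The function `μ(t) = C₁e^{−λt}(sin ωt − cos ωt) + C₂e^{λt}(sin ωt + cos ωt)`
satisfies the cleared-denominator Ince-type equation
`(ω + λcos(2ωt))μ'' + 2λω sin(2ωt)μ' + (ω³ − 3ωλ² − (ω²λ + λ³)cos(2ωt))μ = 0` for all `t`;
in particular, wherever `ω + λcos(2ωt) ≠ 0`, it solves the characteristic equation of the
degenerate parametric oscillator. -/
theorem ince_general_solution (lam ω C₁ C₂ : ℝ) :
    (∀ t : ℝ,
      (ω + lam * Real.cos (2 * ω * t)) * deriv (deriv (inceSol lam ω C₁ C₂)) t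
        + 2 * lam * ω * Real.sin (2 * ω * t) * deriv (inceSol lam ω C₁ C₂) t
        + (ω ^ 3 - 3 * ω * lam ^ 2 - (ω ^ 2 * lam + lam ^ 3) * Real.cos (2 * ω * t)) *
            inceSol lam ω C₁ C₂ t = 0) ∧
    (∀ t : ℝ, ω + lam * Real.cos (2 * ω * t) ≠ 0 →
      deriv (deriv (inceSol lam ω C₁ C₂)) t
        + (2 * lam * ω * Real.sin (2 * ω * t) / (ω + lam * Real.cos (2 * ω * t))) *
            deriv (inceSol lam ω C₁ C₂) t
        + ((ω ^ 3 - 3 * ω * lam ^ 2 - (ω ^ 2 * lam + lam ^ 3) * Real.cos (2 * ω * t)) /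
            (ω + lam * Real.cos (2 * ω * t))) * inceSol lam ω C₁ C₂ t = 0) := by
  refine ⟨inceSol_cleared lam ω C₁ C₂, fun t ht => ?_⟩
  have h := inceSol_cleared lam ω C₁ C₂ t
  field_simp
  linear_combination h
end

section
/- Let λ and ω be real numbers. Define μ₀(t) := sin(ωt)·cosh(λt) + cos(ωt)·sinh(λt) and μ₁(t) := sin(ωt)·sinh(λt) + cos(ωt)·cosh(λt). Then for every real t both μ₀ and μ₁ satisfy the cleared-denominator Ince-type equation (ω + λ·cos(2ωt))·μ''(t) + 2λω·sin(2ωt)·μ'(t) + ( ω³ − 3ωλ² − (ω²λ + λ³)·cos(2ωt) )·μ(t) = 0, and they satisfy the initial conditions μ₀(0) = 0, μ₀'(0) = ω + λ, μ₁(0) = 1, μ₁'(0) = 0. -/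
open Real

/-- `μ₀(t) = sin(ωt)cosh(λt) + cos(ωt)sinh(λt)`. -/
noncomputable def mu0 (lam ω : ℝ) (t : ℝ) : ℝ :=
  Real.sin (ω * t) * Real.cosh (lam * t) + Real.cos (ω * t) * Real.sinh (lam * t)

/-- `μ₁(t) = sin(ωt)sinh(λt) + cos(ωt)cosh(λt)`. -/
noncomputable def mu1 (lam ω : ℝ) (t : ℝ) : ℝ :=
  Real.sin (ω * t) * Real.sinh (lam * t) + Real.cos (ω * t) * Real.cosh (lam * t)

theorem hasDerivAt_sin_const_mul (a t : ℝ) :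
    HasDerivAt (fun t => Real.sin (a * t)) (a * Real.cos (a * t)) t := by
  simpa [mul_comm] using ((hasDerivAt_id t).const_mul a).sin

theorem hasDerivAt_cos_const_mul (a t : ℝ) :
    HasDerivAt (fun t => Real.cos (a * t)) (-(a * Real.sin (a * t))) t := by
  simpa [mul_comm] using ((hasDerivAt_id t).const_mul a).cos

theorem hasDerivAt_sinh_const_mul (a t : ℝ) :
    HasDerivAt (fun t => Real.sinh (a * t)) (a * Real.cosh (a * t)) t := by
  simpa [mul_comm] using ((hasDerivAt_id t).const_mul a).sinh

theorem hasDerivAt_cosh_const_mul (a t : ℝ) :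
    HasDerivAt (fun t => Real.cosh (a * t)) (a * Real.sinh (a * t)) t := by
  simpa [mul_comm] using ((hasDerivAt_id t).const_mul a).cosh

theorem deriv_mu0 (lam ω : ℝ) :
    deriv (mu0 lam ω) = fun t =>
      (ω + lam) * (Real.cos (ω * t) * Real.cosh (lam * t)) +
        (lam - ω) * (Real.sin (ω * t) * Real.sinh (lam * t)) := by
  funext t
  refine (((hasDerivAt_sin_const_mul ω t).mul (hasDerivAt_cosh_const_mul lam t)).add
    ((hasDerivAt_cos_const_mul ω t).mul (hasDerivAt_sinh_const_mul lam t))).deriv.trans ?_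
  ring

theorem deriv_deriv_mu0 (lam ω t : ℝ) :
    deriv (deriv (mu0 lam ω)) t =
      (lam ^ 2 - ω ^ 2 - 2 * ω * lam) * (Real.sin (ω * t) * Real.cosh (lam * t)) +
        (lam ^ 2 - ω ^ 2 + 2 * ω * lam) * (Real.cos (ω * t) * Real.sinh (lam * t)) := by
  rw [deriv_mu0]
  refine ((((hasDerivAt_cos_const_mul ω t).mul
    (hasDerivAt_cosh_const_mul lam t)).const_mul (ω + lam)).add
    (((hasDerivAt_sin_const_mul ω t).mul
    (hasDerivAt_sinh_const_mul lam t)).const_mul (lam - ω))).deriv.trans ?_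
  ring

theorem deriv_mu1 (lam ω : ℝ) :
    deriv (mu1 lam ω) = fun t =>
      (ω + lam) * (Real.cos (ω * t) * Real.sinh (lam * t)) +
        (lam - ω) * (Real.sin (ω * t) * Real.cosh (lam * t)) := by
  funext t
  refine (((hasDerivAt_sin_const_mul ω t).mul (hasDerivAt_sinh_const_mul lam t)).add
    ((hasDerivAt_cos_const_mul ω t).mul (hasDerivAt_cosh_const_mul lam t))).deriv.trans ?_
  ring

theorem deriv_deriv_mu1 (lam ω t : ℝ) :
    deriv (deriv (mu1 lam ω)) t =
      (lam ^ 2 - ω ^ 2 - 2 * ω * lam) * (Real.sin (ω * t) * Real.sinh (lam * t)) +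
        (lam ^ 2 - ω ^ 2 + 2 * ω * lam) * (Real.cos (ω * t) * Real.cosh (lam * t)) := by
  rw [deriv_mu1]
  refine ((((hasDerivAt_cos_const_mul ω t).mul
    (hasDerivAt_sinh_const_mul lam t)).const_mul (ω + lam)).add
    (((hasDerivAt_sin_const_mul ω t).mul
    (hasDerivAt_cosh_const_mul lam t)).const_mul (lam - ω))).deriv.trans ?_
  ring

/-- The Ince-type equation for `sin(ωt) A + cos(ωt) B`, with `A` and `B` the values of the two
hyperbolic functions at `λt` and the derivatives already computed. -/
theorem ince_identity (lam ω t A B : ℝ) :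
    (ω + lam * Real.cos (2 * ω * t)) *
        ((lam ^ 2 - ω ^ 2 - 2 * ω * lam) * (Real.sin (ω * t) * A) +
          (lam ^ 2 - ω ^ 2 + 2 * ω * lam) * (Real.cos (ω * t) * B))
      + 2 * lam * ω * Real.sin (2 * ω * t) *
        ((ω + lam) * (Real.cos (ω * t) * A) + (lam - ω) * (Real.sin (ω * t) * B))
      + (ω ^ 3 - 3 * ω * lam ^ 2 - (ω ^ 2 * lam + lam ^ 3) * Real.cos (2 * ω * t)) *
        (Real.sin (ω * t) * A + Real.cos (ω * t) * B) = 0 := by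
  have h := Real.sin_sq_add_cos_sq (ω * t)
  rw [mul_assoc 2 ω t, Real.cos_two_mul, Real.sin_two_mul]
  linear_combination
    (4 * lam * ω * (lam - ω) * Real.cos (ω * t) * B) * h

/-- Both `μ₀` and `μ₁` satisfy the cleared-denominator Ince-type equation
`(ω + λcos(2ωt))μ'' + 2λω sin(2ωt)μ' + (ω³ − 3ωλ² − (ω²λ + λ³)cos(2ωt))μ = 0` for all `t`,
with initial conditions `μ₀(0) = 0`, `μ₀'(0) = ω + λ`, `μ₁(0) = 1`, `μ₁'(0) = 0`. -/
theorem ince_fundamental_solutions (lam ω : ℝ) :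
    (∀ t : ℝ,
      (ω + lam * Real.cos (2 * ω * t)) * deriv (deriv (mu0 lam ω)) t
        + 2 * lam * ω * Real.sin (2 * ω * t) * deriv (mu0 lam ω) t
        + (ω ^ 3 - 3 * ω * lam ^ 2 - (ω ^ 2 * lam + lam ^ 3) * Real.cos (2 * ω * t)) *
            mu0 lam ω t = 0) ∧
    (∀ t : ℝ,
      (ω + lam * Real.cos (2 * ω * t)) * deriv (deriv (mu1 lam ω)) t
        + 2 * lam * ω * Real.sin (2 * ω * t) * deriv (mu1 lam ω) t
        + (ω ^ 3 - 3 * ω * lam ^ 2 - (ω ^ 2 * lam + lam ^ 3) * Real.cos (2 * ω * t)) *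
            mu1 lam ω t = 0) ∧
    mu0 lam ω 0 = 0 ∧ deriv (mu0 lam ω) 0 = ω + lam ∧
    mu1 lam ω 0 = 1 ∧ deriv (mu1 lam ω) 0 = 0 := by
  refine ⟨fun t => ?_, fun t => ?_, ?_, ?_, ?_, ?_⟩
  · rw [deriv_deriv_mu0, deriv_mu0]
    exact ince_identity lam ω t _ _
  · rw [deriv_deriv_mu1, deriv_mu1]
    exact ince_identity lam ω t _ _
  · simp [mu0]
  · simp [deriv_mu0]
  · simp [mu1]
  · simp [deriv_mu1]
end
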